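/- arXiv:0901.1174 — 4 statements merged into one kernel-verified Lean document; each statement's English description precedes it below -/
import Mathlib

section
/- Let (R, m) be a commutative noetherian local ring, X a finitely generated R-module, and p a prime ideal in NF(X). Then there exists a finitely generated R-module Y in the resolving closure res X satisfying: (1) step(X,Y) ≤ 2·ht_{NF(X)}(p); (2) p ∈ NF(Y); and (3) ht_{NF(Y)}(p) = 0, i.e., p is minimal in NF(Y). -/
open CategoryTheory

noncomputable section

variable (R : Type) [CommRing R]

/-- The nonfree locus of a module: primes where the localization is not free. -/
def nonfreeLocus (M : ModuleCat R) : Set (PrimeSpectrum R) :=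
  {p | ¬ Module.Free (Localization.AtPrime p.asIdeal)
      (LocalizedModule p.asIdeal.primeCompl M)}

/-- The nonfree locus of a class of modules. -/
def nonfreeLocusSet (𝒳 : Set (ModuleCat R)) : Set (PrimeSpectrum R) :=
  ⋃ X ∈ 𝒳, nonfreeLocus R X

/-- `N` is a direct summand of `M`. -/
def IsSummand (N M : ModuleCat R) : Prop :=
  ∃ (i : N ⟶ M) (p : M ⟶ N), i ≫ p = 𝟙 N

/-- `0 → L → M → N → 0` is a short exact sequence. -/
def SES (L M N : ModuleCat R) : Prop :=
  ∃ (f : L ⟶ M) (g : M ⟶ N),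
    Function.Injective f ∧ Function.Surjective g ∧ Function.Exact f g

/-- A resolving class of finitely generated modules. -/
structure IsResolving (𝒳 : Set (ModuleCat R)) : Prop where
  finite : ∀ M ∈ 𝒳, Module.Finite R M
  iso_closed : ∀ M N : ModuleCat R, Nonempty (M ≅ N) → M ∈ 𝒳 → N ∈ 𝒳
  proj_mem : ∀ M : ModuleCat R, Module.Finite R M → Module.Projective R M → M ∈ 𝒳
  summand_closed : ∀ M N : ModuleCat R, IsSummand R N M → M ∈ 𝒳 → N ∈ 𝒳
  ext_closed : ∀ L M N : ModuleCat R, SES R L M N → L ∈ 𝒳 → N ∈ 𝒳 → M ∈ 𝒳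
  ker_epi_closed : ∀ L M N : ModuleCat R, SES R L M N → M ∈ 𝒳 → N ∈ 𝒳 → L ∈ 𝒳

/-- The resolving closure of a class of modules. -/
def resClosure (𝒳 : Set (ModuleCat R)) : Set (ModuleCat R) :=
  ⋂₀ {𝒴 | IsResolving R 𝒴 ∧ 𝒳 ⊆ 𝒴}

/-- Finite direct sum of a family of modules. -/
def finDirectSum {n : ℕ} (f : Fin n → ModuleCat R) : ModuleCat R :=
  ModuleCat.of R (∀ i, f i)

/-- The class `res^n X`. -/
def resStep (X : ModuleCat R) : ℕ → Set (ModuleCat R)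
  | 0 => {M | ∃ (n : ℕ) (f : Fin n → ModuleCat R),
      (∀ i, f i = X ∨ f i = ModuleCat.of R R) ∧ IsSummand R M (finDirectSum R f)}
  | (n+1) => {M | ∃ (t : ℕ) (f : Fin t → ModuleCat R),
      (∀ i, (∃ A B, A ∈ resStep X n ∧ B ∈ resStep X n ∧ SES R A (f i) B) ∨
            (∃ A B, A ∈ resStep X n ∧ B ∈ resStep X n ∧ SES R (f i) A B)) ∧
      IsSummand R M (finDirectSum R f)}

/-- `step(X,Y)` : the least `n` with `Y ∈ res^n X`. -/
def step (X Y : ModuleCat R) : ℕ∞ :=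
  sInf {n : ℕ∞ | ∃ m : ℕ, n = (m : ℕ∞) ∧ Y ∈ resStep R X m}

/-- A module is indecomposable. -/
def Indec (M : ModuleCat R) : Prop :=
  Nontrivial M ∧ ∀ (A B : ModuleCat R), Nontrivial A → Nontrivial B →
    IsEmpty (M ≅ ModuleCat.of R (A × B))

/-- `Ext¹`. -/
def ext1 (X Y : ModuleCat R) : ModuleCat R :=
  ((Ext R (ModuleCat R) 1).obj (Opposite.op X)).obj Y

/-- Dimension of a subset of `Spec R` : `sup { dim R/p }`. -/
def dimSet (Z : Set (PrimeSpectrum R)) : WithBot ℕ∞ :=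
  ⨆ p ∈ Z, ringKrullDim (R ⧸ (p : PrimeSpectrum R).asIdeal)

/-- The height of `p` with respect to a subset `Z` of `Spec R`. -/
def heightWithin (Z : Set (PrimeSpectrum R)) (p : PrimeSpectrum R) : ℕ∞ :=
  ⨆ q ∈ Z, ⨆ (h : q ≤ p), Order.height (α := Set.Icc q p) ⟨p, ⟨h, le_rfl⟩⟩

/-- Depth of a module over a local ring : the supremum of lengths of regular
sequences contained in the maximal ideal. -/
def moduleDepth [IsLocalRing R] (M : Type) [AddCommGroup M] [Module R M] : ℕ∞ :=
  ⨆ (rs : List R) (_ : (∀ r ∈ rs, r ∈ IsLocalRing.maximalIdeal R) ∧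
      RingTheory.Sequence.IsRegular M rs), (rs.length : ℕ∞)

/-- The singular locus: primes `p` such that `R_p` is not regular, i.e. the maximal
ideal of `R_p` cannot be generated by `dim R_p` elements. -/
def singularLocus : Set (PrimeSpectrum R) :=
  {p | ¬ ∃ (s : Finset (Localization.AtPrime p.asIdeal)),
      Ideal.span (s : Set (Localization.AtPrime p.asIdeal)) =
        IsLocalRing.maximalIdeal (Localization.AtPrime p.asIdeal) ∧
      (s.card : WithBot ℕ∞) = ringKrullDim (Localization.AtPrime p.asIdeal)}

end

section Twist

variable {A F X : Type*} [CommRing A] [AddCommGroup F] [Module A F] [AddCommGroup X] [Module A X]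

/-- The map `(f, m) ↦ π f - x m`. Its kernel is the pullback of `π` along multiplication by `x`. -/
def twistMap (π : F →ₗ[A] X) (x : A) : F × X →ₗ[A] X :=
  π ∘ₗ LinearMap.fst A F X - x • LinearMap.snd A F X

@[simp]
lemma twistMap_apply (π : F →ₗ[A] X) (x : A) (v : F × X) : twistMap π x v = π v.1 - x • v.2 := rfl

lemma twistMap_surjective {π : F →ₗ[A] X} (hπ : Function.Surjective π) (x : A) :
    Function.Surjective (twistMap π x) := fun m ↦ by
  obtain ⟨f, rfl⟩ := hπ m
  exact ⟨(f, 0), by simp⟩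

lemma projective_ker_of_projective {M N : Type*} [AddCommGroup M] [Module A M] [AddCommGroup N]
    [Module A N] [Module.Projective A M] [Module.Projective A N] {g : M →ₗ[A] N}
    (hg : Function.Surjective g) : Module.Projective A (LinearMap.ker g) := by
  obtain ⟨s, hs⟩ := Module.projective_lifting_property g LinearMap.id hg
  have hs' (n : N) : g (s n) = n := LinearMap.congr_fun hs n
  refine Module.Projective.of_split (LinearMap.ker g).subtype
    ((LinearMap.id - s ∘ₗ g).codRestrict _ fun v ↦ by simp [hs']) ?_
  ext v
  simp [LinearMap.mem_ker.mp v.2]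

lemma projective_ker_twistMap_of_isUnit [Module.Projective A F] (π : F →ₗ[A] X) {x : A}
    (hx : IsUnit x) : Module.Projective A (LinearMap.ker (twistMap π x)) := by
  obtain ⟨u, rfl⟩ := hx
  refine Module.Projective.of_split (M := F)
    (LinearMap.fst A F X ∘ₗ (LinearMap.ker (twistMap π (u : A))).subtype)
    ((LinearMap.id.prod ((↑u⁻¹ : A) • π)).codRestrict _ fun f ↦ by simp [smul_smul]) ?_
  ext v
  · simp
  · have h := LinearMap.mem_ker.mp v.2
    rw [twistMap_apply, sub_eq_zero] at h
    simp [h, smul_smul]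

lemma bijective_id_sub_smul [IsLocalRing A] {M : Type*} [AddCommGroup M] [Module A M]
    [Module.Finite A M] {x : A} (hx : x ∈ IsLocalRing.maximalIdeal A) (h : M →ₗ[A] M) :
    Function.Bijective (LinearMap.id - x • h : M →ₗ[A] M) := by
  refine OrzechProperty.bijective_of_surjective_endomorphism _ ?_
  rw [← LinearMap.range_eq_top, eq_top_iff]
  refine Submodule.le_of_le_smul_of_le_jacobson_bot (I := IsLocalRing.maximalIdeal A)
    Module.Finite.fg_top (IsLocalRing.maximalIdeal_le_jacobson _) fun m _ ↦ ?_
  have : m = (LinearMap.id - x • h : M →ₗ[A] M) m + x • h m := by simp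
  rw [this]
  exact Submodule.add_mem_sup ⟨m, rfl⟩ (Submodule.smul_mem_smul hx trivial)

/-- If the pullback of `π` along multiplication by an element of the maximal ideal is projective,
then so is the target of `π`. -/
lemma projective_of_projective_ker_twistMap [IsLocalRing A] {π : F →ₗ[A] X}
    [Module.Finite A (LinearMap.ker π)] (hπ : Function.Surjective π) {x : A}
    (hx : x ∈ IsLocalRing.maximalIdeal A)
    [Module.Projective A (LinearMap.ker (twistMap π x))] : Module.Projective A X := by
  set K := LinearMap.ker (twistMap π x)
  have hK (v : K) : π v.1.1 = x • v.1.2 := sub_eq_zero.mp (LinearMap.mem_ker.mp v.2)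
  let q : K →ₗ[A] X := LinearMap.snd A F X ∘ₗ K.subtype
  have hq : Function.Surjective q := fun m ↦ by
    obtain ⟨f, hf⟩ := hπ (x • m)
    exact ⟨⟨(f, m), by simp [K, hf]⟩, rfl⟩
  let ι : LinearMap.ker π →ₗ[A] K :=
    (LinearMap.inl A F X ∘ₗ (LinearMap.ker π).subtype).codRestrict K fun w ↦ by simp [K]
  have hι_coe (w : LinearMap.ker π) : (ι w : F × X) = (w.1, 0) := rfl
  have hι : Function.Exact ι q := fun v ↦ by
    constructor
    · intro hv
      have hv' : v.1.2 = 0 := hv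
      refine ⟨⟨v.1.1, by simp [hK, hv']⟩, ?_⟩
      exact Subtype.ext (Prod.ext rfl hv'.symm)
    · rintro ⟨w, rfl⟩
      rfl
  obtain ⟨l, hl⟩ := Module.projective_lifting_property π q hπ
  have hl' (v : K) : π (l v) = v.1.2 := LinearMap.congr_fun hl v
  let h : LinearMap.ker π →ₗ[A] LinearMap.ker π :=
    (l ∘ₗ ι).codRestrict _ fun w ↦ by simp [hl', hι_coe]
  let e := LinearEquiv.ofBijective _ (bijective_id_sub_smul hx h)
  let ρ : K →ₗ[A] LinearMap.ker π :=
    (LinearMap.fst A F X ∘ₗ K.subtype - x • l).codRestrict _ fun v ↦ by simp [hK, hl']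
  have hρ (w : LinearMap.ker π) : ρ (ι w) = e w := by
    ext
    change w.1 - x • l (ι w) = _
    simp [e, h]
  obtain ⟨-, s, hs⟩ := ((hι.split_tfae').out 1 0 rfl rfl).mp
    ⟨hq, e.symm.toLinearMap ∘ₗ ρ, by ext w; simp [hρ]⟩
  exact Module.Projective.of_split s q hs

end Twist

section Locus

variable {R : Type*} [CommRing R] {F X : Type*} [AddCommGroup F] [Module R F]
  [AddCommGroup X] [Module R X]

lemma mem_freeLocus_iff_projective [Module.Finite R X] (q : PrimeSpectrum R) :
    q ∈ Module.freeLocus R X ↔ Module.Projective (Localization.AtPrime q.asIdeal)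
      (LocalizedModule q.asIdeal.primeCompl X) := by
  rw [Module.mem_freeLocus]
  exact ⟨fun _ ↦ inferInstance, fun _ ↦ Module.free_of_flat_of_isLocalRing⟩

lemma mem_freeLocus_ker_twistMap_iff [IsNoetherianRing R] [Module.Finite R F] [Module.Finite R X] (π : F →ₗ[R] X)
    (x : R) (q : PrimeSpectrum R) :
    q ∈ Module.freeLocus R (LinearMap.ker (twistMap π x)) ↔
      Module.Projective (Localization.AtPrime q.asIdeal)
        (LinearMap.ker (twistMap (LocalizedModule.map q.asIdeal.primeCompl π)
          (algebraMap R (Localization.AtPrime q.asIdeal) x))) := by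
  let S := q.asIdeal.primeCompl
  let A := Localization.AtPrime q.asIdeal
  let j := (LocalizedModule.mkLinearMap S F).prodMap (LocalizedModule.mkLinearMap S X)
  have key : (LinearMap.ker (twistMap π x)).localized' A S j =
      LinearMap.ker (twistMap (LocalizedModule.map S π) (algebraMap R A x)) := by
    rw [LinearMap.localized'_ker_eq_ker_localizedMap A S j (LocalizedModule.mkLinearMap S X)]
    congr 1
    apply LinearMap.restrictScalars_injective R
    apply IsLocalizedModule.linearMap_ext S j (LocalizedModule.mkLinearMap S X)
    apply LinearMap.ext
    intro v
    have h1 := IsLocalizedModule.map_apply S j (LocalizedModule.mkLinearMap S X) (twistMap π x) v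
    have h2 : LocalizedModule.map S π (LocalizedModule.mkLinearMap S F v.1) =
        LocalizedModule.mkLinearMap S X (π v.1) := by
      simp
    simp only [LinearMap.comp_apply, LinearMap.restrictScalars_apply,
      LinearMap.extendScalarsOfIsLocalization_apply']
    rw [h1]
    simp only [twistMap_apply, j, LinearMap.prodMap_apply, h2, map_sub, map_smul]
    exact congrArg _ (algebraMap_smul A x _).symm
  rw [Module.mem_freeLocus_of_isLocalization q A _
    (Submodule.toLocalized' A S j (LinearMap.ker (twistMap π x))), key]
  exact ⟨fun _ ↦ inferInstance, fun _ ↦ Module.free_of_flat_of_isLocalRing⟩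

variable [IsNoetherianRing R] [Module.Finite R F] [Module.Finite R X] {π : F →ₗ[R] X}

lemma mem_freeLocus_ker_twistMap [Module.Free R F] (hπ : Function.Surjective π) {x : R} {q : PrimeSpectrum R}
    (h : q ∈ Module.freeLocus R X ∨ x ∉ q.asIdeal) :
    q ∈ Module.freeLocus R (LinearMap.ker (twistMap π x)) := by
  rw [mem_freeLocus_ker_twistMap_iff]
  have := Module.free_of_isLocalizedModule (Rₛ := Localization.AtPrime q.asIdeal)
    q.asIdeal.primeCompl (LocalizedModule.mkLinearMap q.asIdeal.primeCompl F)
  rcases h with h | h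
  · rw [mem_freeLocus_iff_projective] at h
    exact projective_ker_of_projective
      (twistMap_surjective (LocalizedModule.map_surjective _ π hπ) _)
  · exact projective_ker_twistMap_of_isUnit _
      (IsLocalization.map_units (Localization.AtPrime q.asIdeal)
        (⟨x, h⟩ : q.asIdeal.primeCompl))

lemma mem_freeLocus_of_mem_freeLocus_ker_twistMap (hπ : Function.Surjective π) {x : R}
    {q : PrimeSpectrum R} (hx : x ∈ q.asIdeal)
    (h : q ∈ Module.freeLocus R (LinearMap.ker (twistMap π x))) : q ∈ Module.freeLocus R X := by
  rw [mem_freeLocus_ker_twistMap_iff] at h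
  rw [mem_freeLocus_iff_projective]
  exact projective_of_projective_ker_twistMap (LocalizedModule.map_surjective _ π hπ)
    ((IsLocalization.AtPrime.to_map_mem_maximal_iff _ q.asIdeal x).mpr hx)

end Locus

section Height

variable {R : Type} [CommRing R]

lemma heightWithin_le_height (Z : Set (PrimeSpectrum R)) (p : PrimeSpectrum R) :
    heightWithin R Z p ≤ Order.height p :=
  iSup₂_le fun _ _ ↦ iSup_le fun h ↦
    Order.height_le_height_apply_of_strictMono Subtype.val (Subtype.strictMono_coe _)
      ⟨p, h, le_rfl⟩

lemma heightWithin_ne_top [IsNoetherianRing R] (Z : Set (PrimeSpectrum R)) (p : PrimeSpectrum R) :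
    heightWithin R Z p ≠ ⊤ := by
  refine ((heightWithin_le_height Z p).trans_lt ?_).ne
  rw [← PrimeSpectrum.height_eq_orderHeight]
  exact Ideal.height_lt_top_of_isPrime

lemma height_Icc_add_one_le {α : Type*} [PartialOrder α] {a b c : α} (hab : a < b) (hbc : b ≤ c) :
    Order.height (α := Set.Icc b c) ⟨c, hbc, le_rfl⟩ + 1 ≤
      Order.height (α := Set.Icc a c) ⟨c, hab.le.trans hbc, le_rfl⟩ := by
  let f : WithBot (Set.Icc b c) → Set.Icc a c :=
    WithBot.recBotCoe ⟨a, le_rfl, hab.le.trans hbc⟩ fun r ↦ ⟨r, hab.le.trans r.2.1, r.2.2⟩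
  have hf : StrictMono f := by
    intro r s hrs
    induction s with
    | bot => exact absurd hrs not_lt_bot
    | coe s =>
      induction r with
      | bot => exact hab.trans_le s.2.1
      | coe r =>
        have hrs' : r < s := WithBot.coe_lt_coe.mp hrs
        exact hrs'
  rw [← Order.height_coe_withBot]
  exact Order.height_le_height_apply_of_strictMono f hf _

lemma heightWithin_add_one_le {Z W : Set (PrimeSpectrum R)} {p : PrimeSpectrum R} (hp : p ∈ W)
    (h : ∀ q ∈ W, q ≤ p → ∃ q₀ ∈ Z, q₀ < q) :
    heightWithin R W p + 1 ≤ heightWithin R Z p := by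
  have key (q : PrimeSpectrum R) (hq : q ∈ W) (hqp : q ≤ p) :
      Order.height (α := Set.Icc q p) ⟨p, hqp, le_rfl⟩ + 1 ≤ heightWithin R Z p := by
    obtain ⟨q₀, hq₀, hlt⟩ := h q hq hqp
    exact (height_Icc_add_one_le hlt hqp).trans
      (le_iSup₂_of_le q₀ hq₀ (le_iSup_of_le (hlt.le.trans hqp) le_rfl))
  have hone : 1 ≤ heightWithin R Z p := le_add_self.trans (key p hp le_rfl)
  calc heightWithin R W p + 1 ≤ (heightWithin R Z p - 1) + 1 := by
        gcongr
        exact iSup₂_le fun q hq ↦ iSup_le fun hqp ↦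
          ENat.le_sub_of_add_le_right ENat.one_ne_top (key q hq hqp)
    _ = heightWithin R Z p := tsub_add_cancel_of_le hone

lemma exists_lt_of_heightWithin_ne_zero {Z : Set (PrimeSpectrum R)} {p : PrimeSpectrum R}
    (h : heightWithin R Z p ≠ 0) : ∃ q ∈ Z, q < p := by
  contrapose! h
  refine le_antisymm (iSup₂_le fun q hq ↦ iSup_le fun hqp ↦ ?_) zero_le
  obtain rfl : q = p := hqp.eq_of_not_lt (h q hq)
  rw [nonpos_iff_eq_zero, Order.height_eq_zero]
  exact fun r _ ↦ r.2.1

/-- An element of `p` lying in no minimal element of a closed set in which `p` is not minimal. -/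
lemma exists_mem_asIdeal_notMem_minimal [IsNoetherianRing R] {Z : Set (PrimeSpectrum R)}
    (hZ : IsClosed Z) {p : PrimeSpectrum R} (h : ∃ q ∈ Z, q < p) :
    ∃ x ∈ p.asIdeal, ∀ q ∈ Z, x ∈ q.asIdeal → ∃ q₀ ∈ Z, q₀ < q := by
  obtain ⟨I, rfl⟩ := (PrimeSpectrum.isClosed_iff_zeroLocus_ideal Z).mp hZ
  obtain ⟨q₁, hq₁, hlt⟩ := h
  have hfin := I.finite_minimalPrimes_of_isNoetherianRing
  have hnot : ¬ (p.asIdeal : Set R) ⊆ ⋃ J ∈ (hfin.toFinset : Set (Ideal R)), (J : Set R) := by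
    intro hsub
    obtain ⟨J, hJ, hpJ⟩ := (Ideal.subset_union_prime (f := id) ⊥ ⊥
      fun J hJ _ _ ↦ (hfin.mem_toFinset.mp hJ).1.1).mp hsub
    have hJ := hfin.mem_toFinset.mp hJ
    have : q₁.asIdeal < J := lt_of_lt_of_le hlt hpJ
    exact this.not_ge (hJ.2 ⟨q₁.isPrime, hq₁⟩ this.le)
  obtain ⟨x, hxp, hx⟩ := Set.not_subset.mp hnot
  refine ⟨x, hxp, fun q hq hxq ↦ ?_⟩
  obtain ⟨J, hJ, hJq⟩ := Ideal.exists_minimalPrimes_le (J := q.asIdeal) hq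
  refine ⟨⟨J, hJ.1.1⟩, hJ.1.2, lt_of_le_of_ne hJq fun heq ↦ hx ?_⟩
  have : J = q.asIdeal := congrArg PrimeSpectrum.asIdeal heq
  simp only [Set.mem_iUnion]
  exact ⟨J, by simpa using hJ, this ▸ hxq⟩

end Height

section Resolving

variable {R : Type} [CommRing R]

lemma isSummand_of_linearMap {N M : ModuleCat.{0} R} (i : N →ₗ[R] M) (r : M →ₗ[R] N)
    (h : r ∘ₗ i = LinearMap.id) : IsSummand R N M :=
  ⟨ModuleCat.ofHom i, ModuleCat.ofHom r, by
    rw [← ModuleCat.ofHom_comp, h]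
    rfl⟩

lemma IsSummand.exists_linearMap {N M : ModuleCat.{0} R} (h : IsSummand R N M) :
    ∃ (i : N →ₗ[R] M) (r : M →ₗ[R] N), r ∘ₗ i = LinearMap.id := by
  obtain ⟨i, r, h⟩ := h
  exact ⟨i.hom, r.hom, by rw [← ModuleCat.hom_comp, h]; rfl⟩

/-- Direct summands of finite direct sums of modules in `𝒜`. -/
def addClosure (𝒜 : Set (ModuleCat.{0} R)) : Set (ModuleCat.{0} R) :=
  {M | ∃ (n : ℕ) (f : Fin n → ModuleCat.{0} R), (∀ i, f i ∈ 𝒜) ∧ IsSummand R M (finDirectSum R f)}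

lemma mem_addClosure_of_pi {𝒜 : Set (ModuleCat.{0} R)} {ι : Type} [Fintype ι] (f : ι → ModuleCat.{0} R)
    (hf : ∀ i, f i ∈ 𝒜) {M : ModuleCat.{0} R} (i : M →ₗ[R] ∀ k, f k) (r : (∀ k, f k) →ₗ[R] M)
    (h : r ∘ₗ i = LinearMap.id) : M ∈ addClosure 𝒜 := by
  let e := (Fintype.equivFin ι).symm
  let E := LinearEquiv.piCongrLeft R (fun k ↦ f k) e
  refine ⟨Fintype.card ι, fun k ↦ f (e k), fun k ↦ hf _, isSummand_of_linearMap
    (E.symm.toLinearMap ∘ₗ i) (r ∘ₗ E.toLinearMap) ?_⟩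
  refine LinearMap.ext fun m ↦ ?_
  change r (E (E.symm (i m))) = m
  rw [E.apply_symm_apply]
  exact LinearMap.congr_fun h m

lemma mem_addClosure_of_mem {𝒜 : Set (ModuleCat.{0} R)} {M : ModuleCat.{0} R} (hM : M ∈ 𝒜) :
    M ∈ addClosure 𝒜 :=
  mem_addClosure_of_pi (ι := Unit) (fun _ ↦ M) (fun _ ↦ hM) (LinearMap.pi fun _ ↦ LinearMap.id)
    (LinearMap.proj ()) rfl

lemma prod_mem_addClosure {𝒜 : Set (ModuleCat.{0} R)} {M N : ModuleCat.{0} R} (hM : M ∈ addClosure 𝒜)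
    (hN : N ∈ addClosure 𝒜) : ModuleCat.of R (M × N) ∈ addClosure 𝒜 := by
  obtain ⟨m, f, hf, hMf⟩ := hM
  obtain ⟨n, g, hg, hNg⟩ := hN
  obtain ⟨i, r, hir⟩ := hMf.exists_linearMap
  obtain ⟨j, s, hjs⟩ := hNg.exists_linearMap
  let E := LinearEquiv.sumPiEquivProdPi R (Fin m) (Fin n) fun k ↦ (Sum.elim f g k : ModuleCat.{0} R)
  refine mem_addClosure_of_pi (Sum.elim f g) (by rintro (k | k); exacts [hf k, hg k])
    (E.symm.toLinearMap ∘ₗ i.prodMap j) (r.prodMap s ∘ₗ E.toLinearMap) ?_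
  refine LinearMap.ext fun v ↦ ?_
  refine (congrArg (r.prodMap s) (E.apply_symm_apply (i.prodMap j v))).trans ?_
  exact Prod.ext (LinearMap.congr_fun hir v.1) (LinearMap.congr_fun hjs v.2)

/-- Modules that are the middle or left term of a short exact sequence whose other terms lie
in `𝒜`. -/
def sesClosure (𝒜 : Set (ModuleCat.{0} R)) : Set (ModuleCat.{0} R) :=
  {M | (∃ A B, A ∈ 𝒜 ∧ B ∈ 𝒜 ∧ SES R A M B) ∨ (∃ A B, A ∈ 𝒜 ∧ B ∈ 𝒜 ∧ SES R M A B)}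

lemma resStep_zero (X : ModuleCat.{0} R) :
    resStep R X 0 = addClosure {M | M = X ∨ M = ModuleCat.of R R} := rfl

lemma resStep_succ (X : ModuleCat.{0} R) (n : ℕ) :
    resStep R X (n + 1) = addClosure (sesClosure (resStep R X n)) := rfl

lemma mem_resStep_zero (X : ModuleCat.{0} R) : X ∈ resStep R X 0 := by
  rw [resStep_zero]
  exact mem_addClosure_of_mem (Or.inl rfl)

lemma prod_mem_resStep {X M N : ModuleCat.{0} R} {n : ℕ} (hM : M ∈ resStep R X n)
    (hN : N ∈ resStep R X n) : ModuleCat.of R (M × N) ∈ resStep R X n := by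
  cases n with
  | zero =>
    rw [resStep_zero] at *
    exact prod_mem_addClosure hM hN
  | succ n =>
    rw [resStep_succ] at *
    exact prod_mem_addClosure hM hN

lemma punit_mem_addClosure (𝒜 : Set (ModuleCat.{0} R)) : ModuleCat.of R PUnit ∈ addClosure 𝒜 :=
  mem_addClosure_of_pi (ι := Empty) Empty.elim (fun i ↦ i.elim) 0 0 rfl

lemma punit_mem_resStep (X : ModuleCat.{0} R) (n : ℕ) : ModuleCat.of R PUnit ∈ resStep R X n := by
  cases n with
  | zero => exact resStep_zero X ▸ punit_mem_addClosure _
  | succ n => exact resStep_succ X n ▸ punit_mem_addClosure _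

lemma mem_resStep_succ {X M : ModuleCat.{0} R} {n : ℕ} (hM : M ∈ resStep R X n) :
    M ∈ resStep R X (n + 1) := by
  rw [resStep_succ]
  exact mem_addClosure_of_mem (Or.inl ⟨M, ModuleCat.of R PUnit, hM, punit_mem_resStep X n,
    𝟙 M, 0, fun _ _ h ↦ h, fun _ ↦ ⟨0, rfl⟩, fun m ↦ ⟨fun _ ↦ ⟨m, rfl⟩, fun _ ↦ rfl⟩⟩)

lemma free_mem_resStep (X : ModuleCat.{0} R) (k n : ℕ) :
    ModuleCat.of R (Fin k → R) ∈ resStep R X n := by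
  induction n with
  | zero =>
    rw [resStep_zero]
    exact mem_addClosure_of_pi (ι := Fin k) (fun _ ↦ ModuleCat.of R R) (fun _ ↦ Or.inr rfl)
      LinearMap.id LinearMap.id rfl
  | succ n ih => exact mem_resStep_succ ih

lemma ses_prod (M N : ModuleCat.{0} R) : SES R M (ModuleCat.of R (M × N)) N :=
  ⟨ModuleCat.ofHom (LinearMap.inl R M N), ModuleCat.ofHom (LinearMap.snd R M N),
    LinearMap.inl_injective, LinearMap.snd_surjective, Function.Exact.inl_snd⟩

lemma ses_ker {M N : Type} [AddCommGroup M] [Module R M] [AddCommGroup N] [Module R N]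
    (g : M →ₗ[R] N) (hg : Function.Surjective g) :
    SES R (ModuleCat.of R (LinearMap.ker g)) (ModuleCat.of R M) (ModuleCat.of R N) :=
  ⟨ModuleCat.ofHom (LinearMap.ker g).subtype, ModuleCat.ofHom g,
    Subtype.val_injective, hg, LinearMap.exact_subtype_ker_map g⟩

lemma ker_twistMap_mem_resStep {X M : ModuleCat.{0} R} {n k : ℕ} (hM : M ∈ resStep R X n)
    {π : (Fin k → R) →ₗ[R] M} (hπ : Function.Surjective π) (x : R) :
    ModuleCat.of R (LinearMap.ker (twistMap π x)) ∈ resStep R X (n + 1) := by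
  rw [resStep_succ]
  exact mem_addClosure_of_mem (Or.inr ⟨_, M, prod_mem_resStep (free_mem_resStep X k n) hM, hM,
    ses_ker _ (twistMap_surjective hπ x)⟩)

lemma ker_twistMap_mem_resClosure {𝒳 : Set (ModuleCat.{0} R)} {M : ModuleCat.{0} R} {k : ℕ}
    (hM : M ∈ resClosure R 𝒳) {π : (Fin k → R) →ₗ[R] M} (hπ : Function.Surjective π) (x : R) :
    ModuleCat.of R (LinearMap.ker (twistMap π x)) ∈ resClosure R 𝒳 := by
  rintro 𝒴 ⟨hres, hsub⟩
  have hM := hM 𝒴 ⟨hres, hsub⟩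
  refine hres.ker_epi_closed _ _ M (ses_ker _ (twistMap_surjective hπ x)) ?_ hM
  have hF : ModuleCat.of R (Fin k → R) ∈ 𝒴 :=
    hres.proj_mem _ (inferInstanceAs (Module.Finite R (Fin k → R)))
      (inferInstanceAs (Module.Projective R (Fin k → R)))
  exact hres.ext_closed _ _ M (ses_prod (ModuleCat.of R (Fin k → R)) M) hF hM

lemma exists_heightWithin_add_one_le [IsNoetherianRing R] {X M : ModuleCat.{0} R} {n : ℕ}
    [Module.Finite R M] (hM : M ∈ resClosure R {X}) (hn : M ∈ resStep R X n) {p : PrimeSpectrum R}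
    (hp : p ∈ nonfreeLocus R M) (h0 : heightWithin R (nonfreeLocus R M) p ≠ 0) :
    ∃ Y : ModuleCat.{0} R, Module.Finite R Y ∧ Y ∈ resClosure R {X} ∧ Y ∈ resStep R X (n + 1) ∧
      p ∈ nonfreeLocus R Y ∧
      heightWithin R (nonfreeLocus R Y) p + 1 ≤ heightWithin R (nonfreeLocus R M) p := by
  obtain ⟨k, π, hπ⟩ := Module.Finite.exists_fin' R M
  have : Module.FinitePresentation R M := Module.finitePresentation_of_finite R M
  have hclosed : IsClosed (nonfreeLocus R M) := Module.isOpen_freeLocus.isClosed_compl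
  obtain ⟨x, hxp, hx⟩ :=
    exists_mem_asIdeal_notMem_minimal hclosed (exists_lt_of_heightWithin_ne_zero h0)
  have hpY : p ∈ nonfreeLocus R (ModuleCat.of R (LinearMap.ker (twistMap π x))) :=
    fun h ↦ hp (mem_freeLocus_of_mem_freeLocus_ker_twistMap hπ hxp h)
  refine ⟨ModuleCat.of R (LinearMap.ker (twistMap π x)),
    inferInstanceAs (Module.Finite R (LinearMap.ker (twistMap π x))),
    ker_twistMap_mem_resClosure hM hπ x, ker_twistMap_mem_resStep hn hπ x, hpY,
    heightWithin_add_one_le hpY fun q hq _ ↦ hx q ?_ ?_⟩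
  · exact fun h ↦ hq (mem_freeLocus_ker_twistMap hπ (.inl h))
  · by_contra h
    exact hq (mem_freeLocus_ker_twistMap hπ (.inr h))

lemma exists_mem_resStep_heightWithin_eq_zero [IsNoetherianRing R] {X : ModuleCat.{0} R}
    {p : PrimeSpectrum R} (h : ℕ) : ∀ (n : ℕ) (M : ModuleCat.{0} R), Module.Finite R M →
      M ∈ resClosure R {X} → M ∈ resStep R X n → p ∈ nonfreeLocus R M →
      heightWithin R (nonfreeLocus R M) p ≤ h →
      ∃ Y : ModuleCat.{0} R, Module.Finite R Y ∧ Y ∈ resClosure R {X} ∧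
        (∃ m ≤ n + h, Y ∈ resStep R X m) ∧ p ∈ nonfreeLocus R Y ∧
        heightWithin R (nonfreeLocus R Y) p = 0 := by
  induction h with
  | zero =>
    intro n M hfin hM hn hp hle
    exact ⟨M, hfin, hM, ⟨n, le_rfl, hn⟩, hp, by simpa using hle⟩
  | succ h ih =>
    intro n M hfin hM hn hp hle
    by_cases h0 : heightWithin R (nonfreeLocus R M) p = 0
    · exact ⟨M, hfin, hM, ⟨n, by omega, hn⟩, hp, h0⟩
    · obtain ⟨Y, hYfin, hY, hYn, hpY, hlt⟩ := exists_heightWithin_add_one_le hM hn hp h0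
      have hle' : heightWithin R (nonfreeLocus R Y) p ≤ h := by
        have := hlt.trans hle
        push_cast at this
        exact (ENat.add_le_add_iff_right ENat.one_ne_top).mp this
      obtain ⟨Y', h1, h2, ⟨m, hm, h3⟩, h4, h5⟩ := ih (n + 1) Y hYfin hY hYn hpY hle'
      exact ⟨Y', h1, h2, ⟨m, by omega, h3⟩, h4, h5⟩

end Resolving

/-- For `p ∈ NF(X)` over a noetherian local ring there is
`Y ∈ res X` with `step(X,Y) ≤ 2·ht_{NF(X)}(p)`, `p ∈ NF(Y)` and `p` minimal in
`NF(Y)`. -/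
theorem stmt13 (R : Type) [CommRing R] [IsNoetherianRing R] [IsLocalRing R]
    (X : ModuleCat R) (hX : Module.Finite R X)
    (p : PrimeSpectrum R) (hp : p ∈ nonfreeLocus R X) :
    ∃ Y : ModuleCat R, Module.Finite R Y ∧ Y ∈ resClosure R {X} ∧
      step R X Y ≤ 2 * heightWithin R (nonfreeLocus R X) p ∧
      p ∈ nonfreeLocus R Y ∧
      heightWithin R (nonfreeLocus R Y) p = 0 := by
  obtain ⟨h, hh⟩ := ENat.ne_top_iff_exists.mp (heightWithin_ne_top (nonfreeLocus R X) p)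
  obtain ⟨Y, hfin, hY, ⟨m, hm, hYm⟩, hpY, hY0⟩ :=
    exists_mem_resStep_heightWithin_eq_zero h 0 X hX (fun _ h𝒴 ↦ h𝒴.2 rfl)
      (mem_resStep_zero X) hp hh.ge
  refine ⟨Y, hfin, hY, ?_, hpY, hY0⟩
  calc step R X Y ≤ m := sInf_le ⟨m, rfl, hYm⟩
    _ ≤ ((2 * h : ℕ) : ℕ∞) := by exact_mod_cast (by omega : m ≤ 2 * h)
    _ = 2 * heightWithin R (nonfreeLocus R X) p := by rw [← hh]; push_cast; rfl
end

section
/- Let (R, m) be a commutative noetherian local ring and X a finitely generated R-module that is not free. Then there exists a finitely generated nonfree R-module Y in the resolving closure res X such that step(X,Y) ≤ 2·dim NF(X) and Y is free on the punctured spectrum of R, i.e., Y_p is a free R_p-module for every prime ideal p ≠ m. -/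
open CategoryTheory

section Twist

variable {R F X : Type*} [CommRing R] [AddCommGroup F] [Module R F] [AddCommGroup X] [Module R X]

/-- For `π : F → X` and `x : R`, the kernel of `(f, m) ↦ π f - x • m`, i.e. the pullback of `π`
along multiplication by `x`. -/
def twist (π : F →ₗ[R] X) (x : R) : Submodule R (F × X) :=
  LinearMap.ker (π ∘ₗ LinearMap.fst R F X - x • LinearMap.snd R F X)

lemma mem_twist {π : F →ₗ[R] X} {x : R} {y : F × X} : y ∈ twist π x ↔ π y.1 = x • y.2 := by
  simp [twist, LinearMap.mem_ker, sub_eq_zero]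

/-- The map `f ↦ (x • f, π f)`. -/
def toTwist (π : F →ₗ[R] X) (x : R) : F →ₗ[R] twist π x :=
  ((x • LinearMap.id).prod π).codRestrict _ fun f => by simp [mem_twist]

lemma toTwist_coe (π : F →ₗ[R] X) (x : R) (f : F) :
    (toTwist π x f : F × X) = (x • f, π f) := rfl

/-- The inclusion `ω ↦ (ω, 0)` of the kernel of `π`. -/
def kerToTwist (π : F →ₗ[R] X) (x : R) : LinearMap.ker π →ₗ[R] twist π x :=
  ((LinearMap.inl R F X) ∘ₗ (LinearMap.ker π).subtype).codRestrict _ fun f => by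
    simp [mem_twist]

lemma kerToTwist_coe (π : F →ₗ[R] X) (x : R) (f : LinearMap.ker π) :
    (kerToTwist π x f : F × X) = ((f : F), 0) := rfl

/-- Linear maps between finite modules over a noetherian ring form a finite module. -/
lemma finite_linearMap_of_isNoetherianRing {R M N : Type*} [CommRing R] [IsNoetherianRing R]
    [AddCommGroup M] [Module R M] [AddCommGroup N] [Module R N] [Module.Finite R M]
    [Module.Finite R N] : Module.Finite R (M →ₗ[R] N) := by
  obtain ⟨n, p, hp⟩ := Module.Finite.exists_fin' R M
  exact Module.Finite.of_injective (LinearMap.lcomp R N p)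
    (LinearMap.lcomp_injective_of_surjective p hp)

/-- If the twist by an element of the Jacobson radical is projective, so is the base module. -/
lemma projective_of_projective_twist [IsNoetherianRing R] [Module.Finite R F]
    [Module.Projective R F] {π : F →ₗ[R] X} (hπ : Function.Surjective π) {x : R}
    (hx : x ∈ Ideal.jacobson (⊥ : Ideal R)) [Module.Projective R (twist π x)] :
    Module.Projective R X := by
  have := finite_linearMap_of_isNoetherianRing (R := R) (M := LinearMap.ker π)
    (N := LinearMap.ker π)
  obtain ⟨χ, hχ⟩ := Module.projective_lifting_property π
    (LinearMap.snd R F X ∘ₗ (twist π x).subtype) hπ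
  have hχ (y : twist π x) : π (χ y) = (y : F × X).2 := LinearMap.congr_fun hχ y
  let θ : LinearMap.ker π →ₗ[R] LinearMap.ker π :=
    (χ ∘ₗ kerToTwist π x).codRestrict _ fun ω => by simp [hχ, kerToTwist_coe]
  let h : F →ₗ[R] LinearMap.ker π :=
    (χ ∘ₗ toTwist π x - LinearMap.id).codRestrict _ fun f => by simp [hχ, toTwist_coe]
  have key : LinearMap.id = x • θ - h ∘ₗ (LinearMap.ker π).subtype := by
    ext ω
    have e : toTwist π x (ω : F) = x • kerToTwist π x ω := by
      ext <;> simp [toTwist_coe, kerToTwist_coe]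
    simp [θ, h, e]
  let B : Submodule R (LinearMap.ker π →ₗ[R] LinearMap.ker π) :=
    LinearMap.range (LinearMap.lcomp R (LinearMap.ker π) (LinearMap.ker π).subtype)
  have hB : ⊤ ≤ B := by
    refine Submodule.le_of_le_smul_of_le_jacobson_bot (I := Ideal.span {x}) Module.Finite.fg_top
      (by simpa [Ideal.span_singleton_le_iff_mem] using hx) fun α _ => ?_
    have e : α = -(α ∘ₗ h) ∘ₗ (LinearMap.ker π).subtype + x • (α ∘ₗ θ) := by
      conv_lhs => rw [← LinearMap.comp_id α, key]
      ext ω; simp [add_comm, sub_eq_add_neg]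
    rw [e]
    exact Submodule.add_mem_sup ⟨-(α ∘ₗ h), rfl⟩
      (Submodule.smul_mem_smul (Ideal.mem_span_singleton_self x) trivial)
  obtain ⟨r, hr⟩ := hB (x := LinearMap.id) trivial
  have hex : Function.Exact (LinearMap.ker π).subtype π := LinearMap.exact_subtype_ker_map π
  obtain ⟨s, hs⟩ := ((hex.split_tfae (Submodule.injective_subtype _) hπ).out 0 1 rfl rfl).mpr ⟨r, hr⟩
  exact Module.Projective.of_split s π hs

lemma surjective_sub_smul_snd {π : F →ₗ[R] X} (hπ : Function.Surjective π) (x : R) :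
    Function.Surjective (π ∘ₗ LinearMap.fst R F X - x • LinearMap.snd R F X) := fun m => by
  obtain ⟨f, rfl⟩ := hπ m
  exact ⟨(f, 0), by simp⟩

/-- The kernel of a surjection between projective modules is projective. -/
lemma projective_of_exact {A L M N : Type*} [Ring A] [AddCommGroup L] [Module A L]
    [AddCommGroup M] [Module A M] [AddCommGroup N] [Module A N] [Module.Projective A M]
    [Module.Projective A N] {f : L →ₗ[A] M} {g : M →ₗ[A] N} (hf : Function.Injective f)
    (hg : Function.Surjective g) (hfg : Function.Exact f g) : Module.Projective A L := by
  obtain ⟨s, hs⟩ := Module.projective_lifting_property g LinearMap.id hg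
  obtain ⟨r, hr⟩ := ((hfg.split_tfae hf hg).out 0 1 rfl rfl).mp ⟨s, hs⟩
  exact Module.Projective.of_split f r hr

lemma free_localized_twist_of_free [IsNoetherianRing R] [Module.Finite R F] [Module.Finite R X]
    [Module.Free R F] {π : F →ₗ[R] X} (hπ : Function.Surjective π) (x : R)
    {p : PrimeSpectrum R} (hp : p ∈ Module.freeLocus R X) :
    p ∈ Module.freeLocus R (twist π x) := by
  let S := p.asIdeal.primeCompl
  have h₁ : Module.Free (Localization.AtPrime p.asIdeal) (LocalizedModule S X) := hp
  have h₀ : Module.Free (Localization.AtPrime p.asIdeal) (LocalizedModule S F) :=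
    Module.free_of_flat_of_isLocalRing
  have h₂ : Module.Free (Localization.AtPrime p.asIdeal) (LocalizedModule S (F × X)) :=
    (Module.mem_freeLocus_of_isLocalization p (Localization.AtPrime p.asIdeal)
      (LocalizedModule S F × LocalizedModule S X)
      ((LocalizedModule.mkLinearMap S F).prodMap (LocalizedModule.mkLinearMap S X))).mpr
      inferInstance
  have : Module.Projective (Localization.AtPrime p.asIdeal) (LocalizedModule S (twist π x)) :=
    projective_of_exact (A := Localization.AtPrime p.asIdeal)
      (L := LocalizedModule S (twist π x)) (M := LocalizedModule S (F × X))
      (N := LocalizedModule S X)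
      (LocalizedModule.map_injective S _ (Submodule.injective_subtype (twist π x)))
      (LocalizedModule.map_surjective S _ (surjective_sub_smul_snd hπ x))
      (LocalizedModule.map_exact S _ _ (LinearMap.exact_subtype_ker_map _))
  exact Module.free_of_flat_of_isLocalRing

lemma free_localized_twist_of_notMem [IsNoetherianRing R] [Module.Finite R F] [Module.Finite R X]
    [Module.Free R F] (π : F →ₗ[R] X) {x : R} {p : PrimeSpectrum R} (hp : x ∉ p.asIdeal) :
    p ∈ Module.freeLocus R (twist π x) := by
  let S := p.asIdeal.primeCompl
  let u := IsLocalization.mk' (Localization.AtPrime p.asIdeal) (1 : R) (⟨x, hp⟩ : S)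
  have hu : u * algebraMap R _ x = 1 := by
    simpa [u] using
      IsLocalization.mk'_spec (Localization.AtPrime p.asIdeal) (1 : R) (⟨x, hp⟩ : S)
  let φ := LocalizedModule.map S (LinearMap.fst R F X ∘ₗ (twist π x).subtype)
  let ψ := LocalizedModule.map S (toTwist π x)
  have e : ψ ∘ₗ φ = algebraMap R (Localization.AtPrime p.asIdeal) x • LinearMap.id := by
    have e' : toTwist π x ∘ₗ LinearMap.fst R F X ∘ₗ (twist π x).subtype
        = x • LinearMap.id := by
      ext y
      · simp [toTwist_coe]
      · simpa [toTwist_coe] using mem_twist.mp y.2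
    refine LinearMap.ext fun z => ?_
    have := LinearMap.congr_fun (IsLocalizedModule.map_comp' S
      (LocalizedModule.mkLinearMap S _) (LocalizedModule.mkLinearMap S _)
      (LocalizedModule.mkLinearMap S _) (LinearMap.fst R F X ∘ₗ (twist π x).subtype)
      (toTwist π x)) z
    rw [e', map_smul, IsLocalizedModule.map_id] at this
    exact this.symm.trans (by simp)
  have : Module.Projective (Localization.AtPrime p.asIdeal) (LocalizedModule S (twist π x)) :=
    Module.Projective.of_split φ (u • ψ) (by rw [LinearMap.smul_comp, e, smul_smul, hu, one_smul])
  exact Module.free_of_flat_of_isLocalRing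

end Twist

section ResolvingSteps

variable {R : Type} [CommRing R]

lemma IsSummand.of_linearEquiv {M N : ModuleCat R} (e : M ≃ₗ[R] N) : IsSummand R M N :=
  ⟨ModuleCat.ofHom e.toLinearMap, ModuleCat.ofHom e.symm.toLinearMap, by ext; simp⟩

lemma mem_resStep_zero_self (X : ModuleCat R) : X ∈ resStep R X 0 :=
  ⟨1, fun _ => X, fun _ => .inl rfl,
    .of_linearEquiv (LinearEquiv.funUnique (Fin 1) R X).symm⟩

/-- The direct sum of `X` and a finite free module lies in `res⁰ X`. -/
lemma free_prod_mem_resStep_zero (X : ModuleCat R) (n : ℕ) :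
    ModuleCat.of R ((Fin n → R) × X) ∈ resStep R X 0 := by
  let f : Fin (n + 1) → ModuleCat R := Fin.cons X fun _ => ModuleCat.of R R
  refine ⟨n + 1, f, Fin.cases (.inl rfl) fun _ => .inr rfl, ?_⟩
  exact .of_linearEquiv ((LinearEquiv.prodComm R (Fin n → R) X).trans
    (Fin.consLinearEquiv R fun i => (f i : Type)))

/-- If `Y` is the kernel of an epimorphism from an object of `res⁰ X` to an object of `res⁰ X`,
then `resⁿ Y ⊆ resⁿ⁺¹ X`. -/
lemma resStep_subset_of_ses {X Y A B : ModuleCat R} (hA : A ∈ resStep R X 0)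
    (hB : B ∈ resStep R X 0) (h : SES R Y A B) (n : ℕ) :
    resStep R Y n ⊆ resStep R X (n + 1) := by
  induction n with
  | zero =>
    rintro M ⟨t, f, hf, hM⟩
    refine ⟨t, f, fun i => ?_, hM⟩
    obtain e | e := hf i
    · exact .inr ⟨A, B, hA, hB, e ▸ h⟩
    · refine .inl ⟨ModuleCat.of R R, ModuleCat.of R PUnit, ?_, ?_, e ▸ ?_⟩
      · exact ⟨1, fun _ => ModuleCat.of R R, fun _ => .inr rfl,
          .of_linearEquiv (LinearEquiv.funUnique (Fin 1) R R).symm⟩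
      · exact ⟨0, Fin.elim0, fun i => i.elim0, 0, 0, by ext⟩
      · exact ⟨𝟙 _, 0, fun _ _ h => h, fun y => ⟨0, Subsingleton.elim _ _⟩,
          fun y => ⟨fun _ => ⟨y, rfl⟩, fun _ => rfl⟩⟩
  | succ n ih =>
    rintro M ⟨t, f, hf, hM⟩
    refine ⟨t, f, fun i => (hf i).imp ?_ ?_, hM⟩
    · rintro ⟨C, D, hC, hD, hs⟩
      exact ⟨C, D, ih hC, ih hD, hs⟩
    · rintro ⟨C, D, hC, hD, hs⟩
      exact ⟨C, D, ih hC, ih hD, hs⟩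

lemma twist_ses {F : Type} [AddCommGroup F] [Module R F] {X : ModuleCat R} {π : F →ₗ[R] X}
    (hπ : Function.Surjective π) (x : R) :
    SES R (ModuleCat.of R (twist π x)) (ModuleCat.of R (F × X)) X :=
  ⟨ModuleCat.ofHom (twist π x).subtype,
    ModuleCat.ofHom (π ∘ₗ LinearMap.fst R F X - x • LinearMap.snd R F X),
    Submodule.injective_subtype _, surjective_sub_smul_snd hπ x,
    LinearMap.exact_subtype_ker_map _⟩

lemma twist_mem_of_isResolving {𝒳 : Set (ModuleCat.{0} R)} (h𝒳 : IsResolving R 𝒳) {F : Type}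
    [AddCommGroup F] [Module R F] [Module.Finite R F] [Module.Projective R F] {X : ModuleCat R}
    (hX : X ∈ 𝒳) {π : F →ₗ[R] X} (hπ : Function.Surjective π) (x : R) :
    ModuleCat.of R (twist π x) ∈ 𝒳 := by
  refine h𝒳.ker_epi_closed _ _ _ (twist_ses hπ x) ?_ hX
  refine h𝒳.ext_closed (ModuleCat.of R F) _ X ?_ (h𝒳.proj_mem _ ‹_› ‹_›) hX
  exact ⟨ModuleCat.ofHom (LinearMap.inl R F X), ModuleCat.ofHom (LinearMap.snd R F X),
    LinearMap.inl_injective, LinearMap.snd_surjective, .inl_snd⟩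

end ResolvingSteps

section Dimension

variable {R : Type*} [CommRing R]

lemma ringKrullDim_quotient_add_one_le {p q : Ideal R} [q.IsPrime] (h : q < p) :
    ringKrullDim (R ⧸ p) + 1 ≤ ringKrullDim (R ⧸ q) := by
  obtain ⟨r, hrp, hrq⟩ := Set.exists_of_ssubset h
  refine ringKrullDim_succ_le_of_surjective (Ideal.Quotient.factor h.le)
    (Ideal.Quotient.factor_surjective h.le) (r := Ideal.Quotient.mk q r)
    (mem_nonZeroDivisors_of_ne_zero ?_) ?_
  · rwa [ne_eq, Ideal.Quotient.eq_zero_iff_mem]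
  · simpa [Ideal.Quotient.eq_zero_iff_mem] using hrp

/-- In a noetherian local ring, every closed subset of the spectrum admits an element of the
maximal ideal avoiding its generic points other than the closed point. -/
lemma exists_mem_maximalIdeal_avoiding_generic_points [IsNoetherianRing R] [IsLocalRing R]
    {Z : Set (PrimeSpectrum R)} (hZ : IsClosed Z) :
    ∃ x ∈ IsLocalRing.maximalIdeal R, ∀ p ∈ Z, x ∈ p.asIdeal →
      p.asIdeal = IsLocalRing.maximalIdeal R ∨
      ∃ q ∈ Z, q.asIdeal < p.asIdeal := by
  obtain ⟨I, rfl⟩ := (PrimeSpectrum.isClosed_iff_zeroLocus_ideal Z).mp hZ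
  let s := I.minimalPrimes \ {IsLocalRing.maximalIdeal R}
  have hs : s.Finite := (I.finite_minimalPrimes_of_isNoetherianRing R).subset Set.sdiff_subset
  have hnot : ¬ (IsLocalRing.maximalIdeal R : Set R) ⊆ ⋃ J ∈ s, (J : Set R) := by
    intro hsub
    obtain ⟨J, hJ, hle⟩ := (Ideal.subset_union_prime_finite hs (f := id) ⊥ ⊥
      fun J hJ _ _ => hJ.1.1.1).mp hsub
    have := hJ.1.1.1
    exact hJ.2 ((IsLocalRing.le_maximalIdeal this.ne_top).antisymm hle)
  obtain ⟨x, hx, hxs⟩ := Set.not_subset.mp hnot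
  refine ⟨x, hx, fun p hp hxp => ?_⟩
  obtain ⟨q, hq, hqp⟩ := Ideal.exists_minimalPrimes_le (J := p.asIdeal) hp
  by_cases hqm : q = IsLocalRing.maximalIdeal R
  · exact .inl ((IsLocalRing.le_maximalIdeal p.2.ne_top).antisymm (hqm ▸ hqp))
  · refine .inr ⟨⟨q, hq.1.1⟩, hq.1.2, lt_of_le_of_ne hqp ?_⟩
    rintro rfl
    exact hxs (Set.mem_biUnion (show p.asIdeal ∈ s from ⟨hq, hqm⟩) hxp)

end Dimension

/-- If the nonfree locus of `X` has dimension at most `d`, then `res^d X` contains a nonfree module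
which is free on the punctured spectrum and lies in every resolving class containing `X`. -/
lemma exists_mem_resStep_of_dim_le {R : Type} [CommRing R] [IsNoetherianRing R] [IsLocalRing R]
    (d : ℕ) (X : ModuleCat R) (hX : Module.Finite R X) (hXfree : ¬ Module.Free R X)
    (hd : ∀ p ∈ nonfreeLocus R X, ringKrullDim (R ⧸ p.asIdeal) ≤ d) :
    ∃ Y : ModuleCat R, Module.Finite R Y ∧ (∀ 𝒳, IsResolving R 𝒳 → X ∈ 𝒳 → Y ∈ 𝒳) ∧
      ¬ Module.Free R Y ∧ Y ∈ resStep R X d ∧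
      ∀ p ∈ nonfreeLocus R Y, p.asIdeal = IsLocalRing.maximalIdeal R := by
  induction d generalizing X with
  | zero =>
    refine ⟨X, hX, fun _ _ h => h, hXfree, mem_resStep_zero_self X, fun p hp => ?_⟩
    by_contra hne
    have hlt := lt_of_le_of_ne (IsLocalRing.le_maximalIdeal p.2.ne_top) hne
    have h₁ := (ringKrullDim_quotient_add_one_le hlt).trans (hd p hp)
    have h₂ : (0 : WithBot ℕ∞) ≤ ringKrullDim (R ⧸ IsLocalRing.maximalIdeal R) :=
      ringKrullDim_nonneg_of_nontrivial
    have h₃ := (add_le_add_left h₂ 1).trans h₁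
    norm_num at h₃
  | succ d ih =>
    have hclosed : IsClosed (nonfreeLocus R X) := by
      have := Module.finitePresentation_of_finite R X
      exact (Module.isOpen_freeLocus (R := R) (M := X)).isClosed_compl
    obtain ⟨x, hx, hxZ⟩ := exists_mem_maximalIdeal_avoiding_generic_points hclosed
    obtain ⟨n, π, hπ⟩ := Module.Finite.exists_fin' R X
    let Y := ModuleCat.of R (twist π x)
    have hYfree : ¬ Module.Free R Y := fun _ => by
      have : Module.Projective R (twist π x) := inferInstanceAs (Module.Projective R Y)
      have := projective_of_projective_twist hπ
        (by rwa [IsLocalRing.jacobson_eq_maximalIdeal _ bot_ne_top])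
      exact hXfree Module.free_of_flat_of_isLocalRing
    have hdY : ∀ p ∈ nonfreeLocus R Y, ringKrullDim (R ⧸ p.asIdeal) ≤ d := by
      intro p hp
      have hpX : p ∈ nonfreeLocus R X := fun h => hp (free_localized_twist_of_free hπ x h)
      have hxp : x ∈ p.asIdeal := by
        by_contra h
        exact hp (free_localized_twist_of_notMem π h)
      obtain hpm | ⟨q, hq, hqp⟩ := hxZ p hpX hxp
      · rw [hpm]
        have : ringKrullDim (R ⧸ IsLocalRing.maximalIdeal R) = 0 :=
          ringKrullDim_eq_zero_of_field (IsLocalRing.ResidueField R)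
        rw [this]
        exact_mod_cast Nat.zero_le d
      · have h := (ringKrullDim_quotient_add_one_le hqp).trans (hd q hq)
        push_cast at h
        exact ENat.WithBot.add_le_add_one_right_iff.mp h
    obtain ⟨W, hWfin, hWres, hWfree, hWstep, hW⟩ := ih Y
      (inferInstanceAs (Module.Finite R (twist π x))) hYfree hdY
    exact ⟨W, hWfin, fun 𝒳 h𝒳 hX𝒳 => hWres 𝒳 h𝒳 (twist_mem_of_isResolving h𝒳 hX𝒳 hπ x), hWfree,
      resStep_subset_of_ses (free_prod_mem_resStep_zero X n) (mem_resStep_zero_self X)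
        (twist_ses hπ x) d hWstep, hW⟩

lemma ringKrullDim_quotient_le_dimSet {R : Type} [CommRing R] {Z : Set (PrimeSpectrum R)}
    {p : PrimeSpectrum R} (hp : p ∈ Z) : ringKrullDim (R ⧸ p.asIdeal) ≤ dimSet R Z :=
  le_iSup₂ (f := fun (q : PrimeSpectrum R) (_ : q ∈ Z) => ringKrullDim (R ⧸ q.asIdeal)) p hp

lemma dimSet_le_ringKrullDim {R : Type} [CommRing R] (Z : Set (PrimeSpectrum R)) :
    dimSet R Z ≤ ringKrullDim R :=
  iSup₂_le fun q _ => ringKrullDim_quotient_le q.asIdeal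

lemma exists_dimSet_eq_natCast {R : Type} [CommRing R] [FiniteRingKrullDim R]
    {Z : Set (PrimeSpectrum R)} (hZ : Z.Nonempty) : ∃ d : ℕ, dimSet R Z = d := by
  obtain ⟨p, hp⟩ := hZ
  have hpos : 0 ≤ dimSet R Z :=
    ringKrullDim_nonneg_of_nontrivial.trans (ringKrullDim_quotient_le_dimSet hp)
  have hfin : dimSet R Z ≠ ⊤ :=
    ((dimSet_le_ringKrullDim Z).trans_lt ringKrullDim_lt_top).ne
  obtain ⟨e, he⟩ := WithBot.ne_bot_iff_exists.mp (ne_bot_of_le_ne_bot WithBot.zero_ne_bot hpos)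
  obtain ⟨d, rfl⟩ := ENat.ne_top_iff_exists.mp
    (show e ≠ ⊤ from fun h => hfin (by rw [← he, h, WithBot.coe_top]))
  exact ⟨d, he.symm⟩

lemma nonempty_nonfreeLocus {R : Type} [CommRing R] [IsNoetherianRing R] [IsLocalRing R]
    {X : ModuleCat R} (hX : Module.Finite R X) (hXfree : ¬ Module.Free R X) :
    (nonfreeLocus R X).Nonempty := by
  rw [Set.nonempty_iff_ne_empty]
  intro h
  have := Module.finitePresentation_of_finite R X
  have : Module.Projective R X := Module.freeLocus_eq_univ_iff.mp (Set.compl_empty_iff.mp h)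
  exact hXfree Module.free_of_flat_of_isLocalRing

/-- For a nonfree finitely generated module `X` over a noetherian
local ring there is a nonfree `Y ∈ res X` with `step(X,Y) ≤ 2·dim NF(X)` which is
free on the punctured spectrum. -/
theorem stmt14 (R : Type) [CommRing R] [IsNoetherianRing R] [IsLocalRing R]
    (X : ModuleCat R) (hX : Module.Finite R X) (hXfree : ¬ Module.Free R X) :
    ∃ Y : ModuleCat R, Module.Finite R Y ∧ Y ∈ resClosure R {X} ∧
      ¬ Module.Free R Y ∧
      (step R X Y : WithBot ℕ∞) ≤ 2 * dimSet R (nonfreeLocus R X) ∧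
      ∀ p : PrimeSpectrum R, p.asIdeal ≠ IsLocalRing.maximalIdeal R →
        Module.Free (Localization.AtPrime p.asIdeal)
          (LocalizedModule p.asIdeal.primeCompl Y) := by
  obtain ⟨d, hd⟩ := exists_dimSet_eq_natCast (nonempty_nonfreeLocus hX hXfree)
  obtain ⟨Y, hYfin, hYres, hYfree, hYstep, hY⟩ :=
    exists_mem_resStep_of_dim_le d X hX hXfree fun p hp =>
      (ringKrullDim_quotient_le_dimSet hp).trans hd.le
  refine ⟨Y, hYfin, fun 𝒳 h𝒳 => hYres 𝒳 h𝒳.1 (h𝒳.2 rfl), hYfree, ?_,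
    fun q hq => not_not.mp fun h => hq (hY q h)⟩
  have hstep : step R X Y ≤ d := sInf_le ⟨d, rfl, hYstep⟩
  rw [hd]
  calc (step R X Y : WithBot ℕ∞) ≤ (d : WithBot ℕ∞) := WithBot.coe_le_coe.mpr hstep
    _ ≤ 2 * (d : WithBot ℕ∞) := by
      exact_mod_cast Nat.le_mul_of_pos_left d two_pos
end

section
/- Let (R, m) be a commutative noetherian local ring and 𝒳 a resolving class of finitely generated R-modules. If 𝒳 contains some nonfree R-module, then 𝒳 contains a nonfree R-module Y that is free on the punctured spectrum of R, i.e., Y_p is a free R_p-module for every prime ideal p ≠ m. -/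
open CategoryTheory

namespace LinearMap

variable {R F X : Type*} [CommRing R] [AddCommGroup F] [Module R F] [AddCommGroup X] [Module R X]

/-- The pushout of the inclusion `ker π → F` along multiplication by `x` on `ker π`. -/
abbrev KerSMulPushout (π : F →ₗ[R] X) (x : R) : Type _ :=
  (F × ker π) ⧸ range ((ker π).subtype.prod (x • (LinearMap.id : ker π →ₗ[R] ker π)))

namespace KerSMulPushout

variable (π : F →ₗ[R] X) (x : R)

/-- The map `F → KerSMulPushout π x`. -/
def inl : F →ₗ[R] KerSMulPushout π x := (Submodule.mkQ _) ∘ₗ LinearMap.inl R F (ker π)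

/-- The map `ker π → KerSMulPushout π x`. -/
def inr : ker π →ₗ[R] KerSMulPushout π x := (Submodule.mkQ _) ∘ₗ LinearMap.inr R F (ker π)

/-- The map `KerSMulPushout π x → X` induced by `π`. -/
def desc : KerSMulPushout π x →ₗ[R] X :=
  Submodule.liftQ _ (π ∘ₗ LinearMap.fst R F (ker π)) <| by
    rintro _ ⟨k, rfl⟩
    simp

theorem mk_eq_zero_iff (f : F) (k : ker π) :
    (Submodule.Quotient.mk (f, k) : KerSMulPushout π x) = 0 ↔
      ∃ k' : ker π, (k' : F) = f ∧ x • k' = k := by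
  simp [Submodule.Quotient.mk_eq_zero, LinearMap.mem_range]

theorem inr_injective : Function.Injective (inr π x) := by
  rw [injective_iff_map_eq_zero]
  intro k hk
  obtain ⟨k', h, rfl⟩ := (mk_eq_zero_iff π x 0 k).1 hk
  have : k' = 0 := Subtype.ext h
  simp [this]

theorem exact_inr_desc : Function.Exact (inr π x) (desc π x) := by
  intro y
  induction y using Submodule.Quotient.induction_on with
  | H y =>
    obtain ⟨f, k⟩ := y
    constructor
    · intro h
      refine ⟨k - x • ⟨f, h⟩, ?_⟩
      refine (Submodule.Quotient.eq _).2 ⟨-⟨f, h⟩, ?_⟩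
      ext <;> simp
    · rintro ⟨k', h⟩
      rw [← h]
      simp [inr, desc]

theorem desc_surjective (hπ : Function.Surjective π) : Function.Surjective (desc π x) := by
  intro y
  obtain ⟨f, rfl⟩ := hπ y
  exact ⟨inl π x f, by simp [inl, desc]⟩

theorem smul_eq_zero_of_inl_eq_zero {f : F} (hf : inl π x f = 0) : x • f = 0 := by
  obtain ⟨k', rfl, h⟩ := (mk_eq_zero_iff π x f 0).1 hf
  simpa using congrArg Subtype.val h

theorem exists_inl_eq_smul (y : KerSMulPushout π x) : ∃ f, inl π x f = x • y := by
  induction y using Submodule.Quotient.induction_on with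
  | H y =>
    obtain ⟨f, k⟩ := y
    refine ⟨x • f - k, (Submodule.Quotient.eq _).2 ⟨-k, ?_⟩⟩
    ext <;> simp

/-- If `x` lies in `S`, then `F` and the pushout have the same localization at `S`. -/
theorem isLocalizedModule_comp_inl (S : Submonoid R) (hx : x ∈ S) :
    IsLocalizedModule S (LocalizedModule.mkLinearMap S (KerSMulPushout π x) ∘ₗ inl π x) where
  map_units := IsLocalizedModule.map_units (LocalizedModule.mkLinearMap S (KerSMulPushout π x))
  surj y := by
    obtain ⟨⟨y', s⟩, h⟩ :=
      IsLocalizedModule.surj S (LocalizedModule.mkLinearMap S (KerSMulPushout π x)) y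
    obtain ⟨f, hf⟩ := exists_inl_eq_smul π x y'
    refine ⟨(f, ⟨x, hx⟩ * s), ?_⟩
    simp only [LinearMap.comp_apply, hf, map_smul, mul_smul] at h ⊢
    rw [← h]
    rfl
  exists_of_eq {f₁ f₂} h := by
    obtain ⟨s, hs⟩ := IsLocalizedModule.exists_of_eq (S := S)
      (f := LocalizedModule.mkLinearMap S (KerSMulPushout π x)) h
    refine ⟨⟨x, hx⟩ * s, ?_⟩
    have := smul_eq_zero_of_inl_eq_zero π x (f := s • f₁ - s • f₂) (by
      simpa [sub_eq_zero, Submonoid.smul_def] using hs)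
    simpa [mul_smul, sub_eq_zero, smul_sub, Submonoid.smul_def] using this

/-- Over a local ring, for `x` in the maximal ideal, the pushout is projective only if the
inclusion `ker π → F` splits. -/
theorem projective_of_projective [IsLocalRing R] [Module.Projective R F]
    [Module.Finite R (ker π)] (hπ : Function.Surjective π)
    (hx : x ∈ IsLocalRing.maximalIdeal R) [Module.Projective R (KerSMulPushout π x)] :
    Module.Projective R X := by
  set j : ker π →ₗ[R] F × ker π := (ker π).subtype.prod (x • (LinearMap.id : ker π →ₗ[R] ker π)) with hj
  have hjinj : Function.Injective j := fun a b h ↦ Subtype.ext (congrArg Prod.fst h)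
  obtain ⟨s, hs⟩ := LinearMap.exists_rightInverse_of_surjective (range j).mkQ
    (Submodule.range_mkQ _)
  have hex : Function.Exact j (range j).mkQ := LinearMap.exact_map_mkQ_range j
  obtain ⟨r, hr⟩ := ((hex.split_tfae hjinj (Submodule.mkQ_surjective _)).out 0 1 rfl rfl).1 ⟨s, hs⟩
  set u : ker π →ₗ[R] ker π := (r ∘ₗ LinearMap.inl R F (ker π)) ∘ₗ (ker π).subtype
  have hw (w : ker π) : w = u w + x • r (0, w) := by
    conv_lhs => rw [← LinearMap.id_apply (R := R) w, ← hr]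
    have : j w = ((w : F), 0) + x • (0, w) := by ext <;> simp [hj]
    rw [LinearMap.comp_apply, this, map_add, map_smul]
    rfl
  have husurj : Function.Surjective u := by
    refine u.surjective_of_surjective_comp_mkQ (IsLocalRing.maximalIdeal R)
      (IsLocalRing.maximalIdeal_le_jacobson _) fun y ↦ ?_
    obtain ⟨w, rfl⟩ := Submodule.mkQ_surjective _ y
    refine ⟨w, (Submodule.Quotient.eq _).2 ?_⟩
    have : u w - w = -(x • r (0, w)) := by
      nth_rewrite 2 [hw w]
      abel
    rw [this]
    exact neg_mem (Submodule.smul_mem_smul hx trivial)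
  let e := LinearEquiv.ofBijective u
    (OrzechProperty.bijective_of_surjective_endomorphism u husurj)
  have hsplit : (e.symm.toLinearMap ∘ₗ r ∘ₗ LinearMap.inl R F (ker π)) ∘ₗ (ker π).subtype =
      LinearMap.id := by
    ext1 w
    exact e.symm_apply_apply w
  obtain ⟨l, hl⟩ := (((LinearMap.exact_subtype_ker_map π).split_tfae
    (ker π).subtype_injective hπ).out 0 1 rfl rfl).2 ⟨_, hsplit⟩
  exact .of_split l π hl

end KerSMulPushout

end LinearMap

section FreeLocus

variable {R L M N : Type*} [CommRing R] [AddCommGroup L] [Module R L] [AddCommGroup M]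
  [Module R M] [AddCommGroup N] [Module R N]

/-- A short exact sequence splits at the points where the cokernel is free. -/
theorem Function.Exact.nonempty_localizedModule_equiv_prod {f : L →ₗ[R] M} {g : M →ₗ[R] N}
    (h : Function.Exact f g) (hf : Function.Injective f) (hg : Function.Surjective g)
    {p : PrimeSpectrum R} (hN : p ∈ Module.freeLocus R N) :
    Nonempty (LocalizedModule p.asIdeal.primeCompl M ≃ₗ[Localization.AtPrime p.asIdeal]
      LocalizedModule p.asIdeal.primeCompl L × LocalizedModule p.asIdeal.primeCompl N) := by
  set S := p.asIdeal.primeCompl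
  have : Module.Free (Localization.AtPrime p.asIdeal) (LocalizedModule S N) := hN
  let f' := IsLocalizedModule.mapExtendScalars S (LocalizedModule.mkLinearMap S L)
    (LocalizedModule.mkLinearMap S M) (Localization.AtPrime p.asIdeal) f
  let g' := IsLocalizedModule.mapExtendScalars S (LocalizedModule.mkLinearMap S M)
    (LocalizedModule.mkLinearMap S N) (Localization.AtPrime p.asIdeal) g
  have hf' : Function.Injective f' := IsLocalizedModule.map_injective S _ _ f hf
  have hg' : Function.Surjective g' := IsLocalizedModule.map_surjective S _ _ g hg
  have h' : Function.Exact f' g' := IsLocalizedModule.map_exact S _ _ _ f g h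
  obtain ⟨s, hs⟩ := LinearMap.exists_rightInverse_of_surjective g'
    (LinearMap.range_eq_top.2 hg')
  obtain ⟨e, -⟩ := ((h'.split_tfae hf' hg').out 0 2 rfl rfl).1 ⟨s, hs⟩
  exact ⟨e⟩

theorem Module.mem_freeLocus_of_exact_of_mem_left_of_mem_right {f : L →ₗ[R] M} {g : M →ₗ[R] N}
    (h : Function.Exact f g) (hf : Function.Injective f) (hg : Function.Surjective g)
    {p : PrimeSpectrum R} (hL : p ∈ Module.freeLocus R L) (hN : p ∈ Module.freeLocus R N) :
    p ∈ Module.freeLocus R M := by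
  obtain ⟨e⟩ := h.nonempty_localizedModule_equiv_prod hf hg hN
  rw [Module.mem_freeLocus] at hL hN ⊢
  exact .of_equiv e.symm

theorem Module.mem_freeLocus_of_exact_of_mem_middle_of_mem_right [Module.Finite R L]
    {f : L →ₗ[R] M} {g : M →ₗ[R] N}
    (h : Function.Exact f g) (hf : Function.Injective f) (hg : Function.Surjective g)
    {p : PrimeSpectrum R} (hM : p ∈ Module.freeLocus R M) (hN : p ∈ Module.freeLocus R N) :
    p ∈ Module.freeLocus R L := by
  obtain ⟨e⟩ := h.nonempty_localizedModule_equiv_prod hf hg hN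
  rw [Module.mem_freeLocus] at hM hN ⊢
  have : Module.Projective (Localization.AtPrime p.asIdeal)
      (LocalizedModule p.asIdeal.primeCompl L) :=
    .of_split (e.symm.toLinearMap ∘ₗ LinearMap.inl _ _ _) (LinearMap.fst _ _ _ ∘ₗ e.toLinearMap)
      (by ext1; simp)
  exact Module.free_of_flat_of_isLocalRing

theorem LinearMap.KerSMulPushout.freeLocus_subset [IsNoetherianRing R] [Module.Finite R M]
    [Module.Free R M] (π : M →ₗ[R] N) (hπ : Function.Surjective π) (x : R) :
    Module.freeLocus R N ⊆ Module.freeLocus R (KerSMulPushout π x) := by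
  intro p hp
  refine Module.mem_freeLocus_of_exact_of_mem_left_of_mem_right (exact_inr_desc π x)
    (inr_injective π x) (desc_surjective π x hπ) ?_ hp
  refine Module.mem_freeLocus_of_exact_of_mem_middle_of_mem_right
    (LinearMap.exact_subtype_ker_map π) (ker π).subtype_injective hπ ?_ hp
  rw [Module.freeLocus_eq_univ]
  trivial

theorem LinearMap.KerSMulPushout.mem_freeLocus [Module.Free R M] (π : M →ₗ[R] N) {x : R}
    {p : PrimeSpectrum R} (hx : x ∉ p.asIdeal) :
    p ∈ Module.freeLocus R (KerSMulPushout π x) := by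
  have := isLocalizedModule_comp_inl π x p.asIdeal.primeCompl hx
  exact Module.free_of_isLocalizedModule p.asIdeal.primeCompl
    (LocalizedModule.mkLinearMap p.asIdeal.primeCompl (KerSMulPushout π x) ∘ₗ inl π x)

end FreeLocus

open LinearMap in
/-- If a resolving class has a nonfree module that is not free at a nonmaximal prime `p`, it has
another nonfree module which is free at `p` and wherever the first one is. -/
theorem IsResolving.exists_freeLocus_ssubset {R : Type} [CommRing R] [IsNoetherianRing R]
    [IsLocalRing R] {𝒳 : Set (ModuleCat R)} (h𝒳 : IsResolving R 𝒳) {X : ModuleCat R}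
    (hX : X ∈ 𝒳) (hfree : ¬ Module.Free R X) {p : PrimeSpectrum R}
    (hp : p.asIdeal ≠ IsLocalRing.maximalIdeal R) (hpX : p ∉ Module.freeLocus R X) :
    ∃ Y ∈ 𝒳, ¬ Module.Free R Y ∧ Module.freeLocus R X ⊂ Module.freeLocus R Y := by
  have := h𝒳.finite X hX
  obtain ⟨n, π₀, hπ₀⟩ := Module.Finite.exists_fin' R X
  let F := ULift (Fin n → R)
  let π : F →ₗ[R] X := π₀ ∘ₗ ULift.moduleEquiv.toLinearMap
  have hπ : Function.Surjective π := hπ₀.comp ULift.moduleEquiv.surjective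
  obtain ⟨x, hxm, hxp⟩ := Set.exists_of_ssubset
    ((IsLocalRing.le_maximalIdeal p.2.ne_top).lt_of_ne hp)
  have hF : Module.Free R F := .of_equiv ULift.moduleEquiv.symm
  have hK : ModuleCat.of R (ker π) ∈ 𝒳 :=
    h𝒳.ker_epi_closed _ (ModuleCat.of R F) X
      ⟨ModuleCat.ofHom (ker π).subtype, ModuleCat.ofHom π, (ker π).subtype_injective, hπ,
        exact_subtype_ker_map π⟩
      (h𝒳.proj_mem _ inferInstance inferInstance) hX
  refine ⟨ModuleCat.of R (KerSMulPushout π x), ?_, ?_, ?_⟩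
  · exact h𝒳.ext_closed _ _ _ ⟨ModuleCat.ofHom (KerSMulPushout.inr π x),
      ModuleCat.ofHom (KerSMulPushout.desc π x), KerSMulPushout.inr_injective π x,
      KerSMulPushout.desc_surjective π x hπ, KerSMulPushout.exact_inr_desc π x⟩ hK hX
  · intro hY
    have : Module.Free R (KerSMulPushout π x) := hY
    have := KerSMulPushout.projective_of_projective π x hπ hxm
    exact hfree Module.free_of_flat_of_isLocalRing
  · exact (Set.ssubset_iff_of_subset (KerSMulPushout.freeLocus_subset π hπ x)).2
      ⟨p, KerSMulPushout.mem_freeLocus π hxp, hpX⟩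

/-- A resolving class over a noetherian local ring containing a
nonfree module contains a nonfree module which is free on the punctured
spectrum. -/
theorem stmt16 (R : Type) [CommRing R] [IsNoetherianRing R] [IsLocalRing R]
    (𝒳 : Set (ModuleCat R)) (h𝒳 : IsResolving R 𝒳)
    (h : ∃ X ∈ 𝒳, ¬ Module.Free R X) :
    ∃ Y ∈ 𝒳, ¬ Module.Free R Y ∧
      ∀ p : PrimeSpectrum R, p.asIdeal ≠ IsLocalRing.maximalIdeal R →
        Module.Free (Localization.AtPrime p.asIdeal)
          (LocalizedModule p.asIdeal.primeCompl Y) := by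
  obtain ⟨U, ⟨X, hX, hXfree, hXU⟩, hmax⟩ :=
    wellFounded_gt.has_min
      {U : TopologicalSpace.Opens (PrimeSpectrum R) |
        ∃ X ∈ 𝒳, ¬ Module.Free R X ∧ Module.freeLocus R X = U} (by
      obtain ⟨X, hX, hXfree⟩ := h
      have := h𝒳.finite X hX
      have := Module.finitePresentation_of_finite R X
      exact ⟨⟨Module.freeLocus R X, Module.isOpen_freeLocus⟩, X, hX, hXfree, rfl⟩)
  refine ⟨X, hX, hXfree, fun p hp ↦ ?_⟩
  by_contra hpX
  obtain ⟨Y, hY, hYfree, hlt⟩ := h𝒳.exists_freeLocus_ssubset hX hXfree hp hpX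
  have := h𝒳.finite Y hY
  have := Module.finitePresentation_of_finite R Y
  refine hmax ⟨Module.freeLocus R Y, Module.isOpen_freeLocus⟩ ⟨Y, hY, hYfree, rfl⟩ ?_
  rw [hXU] at hlt
  exact hlt
end

section
/- Let R be a commutative noetherian ring and 𝒳 a class of finitely generated R-modules. Then every prime ideal p in NF(𝒳) is of the form p = √(Ann Ext^1_R(Y,Z)) for some indecomposable finitely generated R-modules Y and Z belonging to the resolving closure res 𝒳. -/
open CategoryTheory

section HomologyAnnihilator

variable {R : Type} [CommRing R]

lemma ShortComplex.mem_annihilator_homology_iff (S : ShortComplex (ModuleCat.{0} R)) (a : R) :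
    a ∈ Module.annihilator R S.homology ↔
      ∀ x : S.X₂, S.g x = 0 → ∃ y : S.X₁, S.f y = a • x := by
  rw [S.moduleCatHomologyIso.toLinearEquiv.annihilator_eq, Module.mem_annihilator]
  constructor
  · intro h x hx
    obtain ⟨y, hy⟩ := (Submodule.Quotient.mk_eq_zero (LinearMap.range S.moduleCatToCycles)
      (x := a • (⟨x, hx⟩ : LinearMap.ker S.g.hom))).1 (h (Submodule.Quotient.mk ⟨x, hx⟩))
    exact ⟨y, congrArg Subtype.val hy⟩
  · intro h m
    obtain ⟨⟨x, hx⟩, rfl⟩ := Submodule.Quotient.mk_surjective _ m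
    obtain ⟨y, hy⟩ := h x hx
    exact (Submodule.Quotient.mk_eq_zero (LinearMap.range S.moduleCatToCycles)
      (x := a • (⟨x, hx⟩ : LinearMap.ker S.g.hom))).2 ⟨y, Subtype.ext hy⟩

lemma mem_annihilator_ext1_iff {Y : ModuleCat.{0} R} (P : ProjectiveResolution Y)
    (Z : ModuleCat.{0} R) (a : R) :
    a ∈ Module.annihilator R (ext1 R Y Z) ↔
      ∀ h : P.complex.X 1 ⟶ Z, P.complex.d 2 1 ≫ h = 0 →
        ∃ g : P.complex.X 0 ⟶ Z, P.complex.d 1 0 ≫ g = a • h := by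
  have e : ext1 R Y Z ≅ ((P.complex.linearYonedaObj R Z).sc' 0 1 2).homology :=
    P.isoExt 1 Z ≪≫ ShortComplex.homologyMapIso
      ((P.complex.linearYonedaObj R Z).isoSc' 0 1 2 (by simp) (by simp))
  rw [e.toLinearEquiv.annihilator_eq, ShortComplex.mem_annihilator_homology_iff]
  rfl

/-- `Ext¹(Y, Z)` is the cokernel of restriction along the inclusion of the kernel of some
surjection `P → Y` with `P` projective; this records the resulting description of its
annihilator. -/
lemma exists_projective_mem_annihilator_ext1_iff (Y : ModuleCat.{0} R) :
    ∃ (P : ModuleCat.{0} R) (π : P →ₗ[R] Y), Module.Projective R P ∧ Function.Surjective π ∧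
      ∀ (Z : ModuleCat.{0} R) (a : R), a ∈ Module.annihilator R (ext1 R Y Z) ↔
        ∀ h : LinearMap.ker π →ₗ[R] Z, ∃ g : P →ₗ[R] Z, ∀ w : LinearMap.ker π, g w = a • h w := by
  let P := projectiveResolution Y
  let π : P.complex.X 0 →ₗ[R] Y := (P.π.f 0).hom
  let d : P.complex.X 1 →ₗ[R] P.complex.X 0 := (P.complex.d 1 0).hom
  have exact₀ : ∀ x, π x = 0 → ∃ y, d y = x := (ShortComplex.moduleCat_exact_iff _).1 P.exact₀
  have exact₁ : ∀ x, d x = 0 → ∃ y, P.complex.d 2 1 y = x :=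
    (ShortComplex.moduleCat_exact_iff _).1 (P.exact_succ 0)
  have hπd : ∀ x, π (d x) = 0 := fun x ↦
    DFunLike.congr_fun (congrArg ModuleCat.Hom.hom P.complex_d_comp_π_f_zero) x
  let d' : P.complex.X 1 →ₗ[R] LinearMap.ker π := d.codRestrict _ hπd
  have hd' : Function.Surjective d' := fun ⟨x, hx⟩ ↦ by
    obtain ⟨y, hy⟩ := exact₀ x hx
    exact ⟨y, Subtype.ext hy⟩
  refine ⟨P.complex.X 0, π, ?_, ?_, fun Z a ↦ ?_⟩
  · exact (IsProjective.iff_projective _).2 (P.projective 0)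
  · exact (ModuleCat.epi_iff_surjective (P.π.f 0)).1 inferInstance
  rw [mem_annihilator_ext1_iff P]
  constructor
  · intro H h
    obtain ⟨g, hg⟩ := H (ModuleCat.ofHom (h ∘ₗ d')) (by
      ext x
      have : d' (P.complex.d 2 1 x) = 0 := Subtype.ext
        (DFunLike.congr_fun (congrArg ModuleCat.Hom.hom (P.complex.d_comp_d 2 1 0)) x)
      change h (d' (P.complex.d 2 1 x)) = 0
      rw [this, map_zero])
    refine ⟨g.hom, fun w ↦ ?_⟩
    obtain ⟨y, rfl⟩ := hd' w
    exact DFunLike.congr_fun (congrArg ModuleCat.Hom.hom hg) y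
  · intro H h hh
    have hker : LinearMap.ker d' ≤ LinearMap.ker h.hom := fun x hx ↦ by
      obtain ⟨y, rfl⟩ := exact₁ x (congrArg Subtype.val hx)
      exact DFunLike.congr_fun (congrArg ModuleCat.Hom.hom hh) y
    let e := d'.quotKerEquivOfSurjective hd'
    obtain ⟨g, hg⟩ := H ((LinearMap.ker d').liftQ h.hom hker ∘ₗ e.symm.toLinearMap)
    refine ⟨ModuleCat.ofHom g, ?_⟩
    ext x
    have h1 : e.symm (d' x) = Submodule.Quotient.mk x := by
      rw [LinearEquiv.symm_apply_eq]; rfl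
    have h2 := hg (d' x)
    simp only [LinearMap.comp_apply, LinearEquiv.coe_coe, h1] at h2
    exact h2

end HomologyAnnihilator

section StableAnnihilator

variable {R : Type} [CommRing R]
variable {L M N Q F : Type} [AddCommGroup L] [Module R L] [AddCommGroup M] [Module R M]
  [AddCommGroup N] [Module R N] [AddCommGroup Q] [Module R Q] [AddCommGroup F] [Module R F]

variable (R M N) in
/-- The linear maps `M → N` that factor through a finite free module. -/
def finiteFreeMaps : Submodule R (M →ₗ[R] N) := LinearMap.range (dualTensorHom R M N)

lemma comp_mem_finiteFreeMaps (g : N →ₗ[R] Q) {f : M →ₗ[R] N} (hf : f ∈ finiteFreeMaps R M N) :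
    g ∘ₗ f ∈ finiteFreeMaps R M Q := by
  obtain ⟨t, rfl⟩ := hf
  refine ⟨g.lTensor _ t, ?_⟩
  induction t with
  | zero => simp
  | tmul l y => ext; simp
  | add s t hs ht => rw [map_add, map_add, hs, ht, map_add, LinearMap.comp_add]

lemma mem_finiteFreeMaps_comp {g : N →ₗ[R] Q} (hg : g ∈ finiteFreeMaps R N Q) (f : M →ₗ[R] N) :
    g ∘ₗ f ∈ finiteFreeMaps R M Q := by
  obtain ⟨t, rfl⟩ := hg
  refine ⟨(Module.Dual.transpose (R := R) f).rTensor _ t, ?_⟩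
  induction t with
  | zero => simp
  | tmul l y => ext; simp [Module.Dual.transpose_apply]
  | add s t hs ht => rw [map_add, map_add, hs, ht, map_add, LinearMap.add_comp]

lemma exists_lift_of_mem_finiteFreeMaps {g : N →ₗ[R] Q} (hg : Function.Surjective g)
    {f : M →ₗ[R] Q} (hf : f ∈ finiteFreeMaps R M Q) :
    ∃ f' ∈ finiteFreeMaps R M N, g ∘ₗ f' = f := by
  obtain ⟨t, rfl⟩ := hf
  induction t with
  | zero => exact ⟨0, zero_mem _, by simp⟩
  | tmul l y =>
    obtain ⟨x, rfl⟩ := hg y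
    exact ⟨_, ⟨l ⊗ₜ x, rfl⟩, by ext; simp⟩
  | add s t hs ht =>
    obtain ⟨u, hu, hu'⟩ := hs
    obtain ⟨v, hv, hv'⟩ := ht
    exact ⟨u + v, add_mem hu hv, by rw [LinearMap.comp_add, hu', hv', map_add]⟩

lemma mem_finiteFreeMaps_of_free [Module.Free R F] [Module.Finite R F] (f : F →ₗ[R] M) :
    f ∈ finiteFreeMaps R F M :=
  (dualTensorHomEquiv R F M).surjective f

variable (R M) in
/-- The ideal of scalars whose action on `M` factors through a finite free module. -/
def stableAnnihilator : Ideal R :=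
  (finiteFreeMaps R M M).comap (LinearMap.toSpanSingleton R (M →ₗ[R] M) LinearMap.id)

lemma mem_stableAnnihilator {a : R} :
    a ∈ stableAnnihilator R M ↔ a • (LinearMap.id : M →ₗ[R] M) ∈ finiteFreeMaps R M M :=
  Iff.rfl

lemma mem_stableAnnihilator_of_comp_eq [Module.Free R F] [Module.Finite R F] {a : R}
    (f : M →ₗ[R] F) (g : F →ₗ[R] M) (h : g ∘ₗ f = a • LinearMap.id) :
    a ∈ stableAnnihilator R M := by
  rw [mem_stableAnnihilator, ← h]
  exact mem_finiteFreeMaps_comp (mem_finiteFreeMaps_of_free g) f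

lemma stableAnnihilator_le_of_retract (i : N →ₗ[R] M) (q : M →ₗ[R] N)
    (h : q ∘ₗ i = LinearMap.id) : stableAnnihilator R M ≤ stableAnnihilator R N := by
  intro a ha
  have h1 := comp_mem_finiteFreeMaps q (mem_finiteFreeMaps_comp ha i)
  rwa [LinearMap.toSpanSingleton_apply, LinearMap.smul_comp, LinearMap.comp_smul,
    LinearMap.id_comp, h] at h1

lemma stableAnnihilator_inf_le_prod :
    stableAnnihilator R M ⊓ stableAnnihilator R N ≤ stableAnnihilator R (M × N) := by
  rintro a ⟨ha, hb⟩
  have h1 := comp_mem_finiteFreeMaps (LinearMap.inl R M N)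
    (mem_finiteFreeMaps_comp ha (LinearMap.fst R M N))
  have h2 := comp_mem_finiteFreeMaps (LinearMap.inr R M N)
    (mem_finiteFreeMaps_comp hb (LinearMap.snd R M N))
  rw [mem_stableAnnihilator]
  convert add_mem h1 h2 using 1
  ext <;> simp

/-- A scalar that factors through a finite free module on `M` extends to a map onto the kernel of
any surjection onto `M`. -/
lemma exists_retraction_of_mem_stableAnnihilator {π : N →ₗ[R] M} (hπ : Function.Surjective π)
    {a : R} (ha : a ∈ stableAnnihilator R M) :
    ∃ r : N →ₗ[R] LinearMap.ker π, ∀ w : LinearMap.ker π, r w = a • w := by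
  obtain ⟨t, -, ht⟩ := exists_lift_of_mem_finiteFreeMaps hπ ha
  have ht' : ∀ y, π (t y) = a • y := fun y ↦ LinearMap.congr_fun ht y
  refine ⟨(a • LinearMap.id - t ∘ₗ π).codRestrict _ fun x ↦ by simp [ht'], fun w ↦ ?_⟩
  ext
  simp

lemma stableAnnihilator_le_ker [Module.Free R F] [Module.Finite R F] {π : F →ₗ[R] M}
    (hπ : Function.Surjective π) :
    stableAnnihilator R M ≤ stableAnnihilator R (LinearMap.ker π) := by
  intro a ha
  obtain ⟨r, hr⟩ := exists_retraction_of_mem_stableAnnihilator hπ ha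
  exact mem_stableAnnihilator_of_comp_eq (LinearMap.ker π).subtype r (LinearMap.ext hr)

lemma mul_mem_stableAnnihilator_of_exact {i : L →ₗ[R] M} {π : M →ₗ[R] N}
    (hi : Function.Injective i) (hπ : Function.Surjective π) (hex : Function.Exact i π)
    {a b : R} (ha : a ∈ stableAnnihilator R L) (hb : b ∈ stableAnnihilator R N) :
    a * b ∈ stableAnnihilator R M := by
  obtain ⟨t, ht, htb⟩ := exists_lift_of_mem_finiteFreeMaps hπ hb
  have ht' : ∀ y, π (t y) = b • y := fun y ↦ LinearMap.congr_fun htb y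
  have hrange : ∀ x, (b • LinearMap.id - t ∘ₗ π : M →ₗ[R] M) x ∈ LinearMap.range i := fun x ↦ by
    rw [← hex.linearMap_ker_eq]
    simp [ht']
  let h : M →ₗ[R] L := (LinearEquiv.ofInjective i hi).symm.toLinearMap ∘ₗ
    (b • LinearMap.id - t ∘ₗ π).codRestrict _ hrange
  have hh : ∀ x, i (h x) = b • x - t (π x) := fun x ↦
    congrArg Subtype.val ((LinearEquiv.ofInjective i hi).apply_symm_apply ⟨_, hrange x⟩)
  have h1 := comp_mem_finiteFreeMaps i (mem_finiteFreeMaps_comp ha h)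
  have h2 := Submodule.smul_mem _ a (mem_finiteFreeMaps_comp ht π)
  rw [mem_stableAnnihilator]
  convert add_mem h1 h2 using 1
  ext x
  simp [hh, smul_sub, mul_smul]

end StableAnnihilator

section ScaledExtension

variable {R : Type} [CommRing R] {F M : Type} [AddCommGroup F] [Module R F]
  [AddCommGroup M] [Module R M] (x : R) (π : F →ₗ[R] M)

/-- The relations `(x w, -w)` defining the pushout of `ker π → F` along multiplication by `x`. -/
def scaledRelations : Submodule R (LinearMap.ker π × F) :=
  LinearMap.range ((x • LinearMap.id).prod (-(LinearMap.ker π).subtype))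

/-- The middle term of the extension obtained by multiplying the extension class of
`0 → ker π → F → M → 0` by `x`. -/
abbrev ScaledExtension : Type := (LinearMap.ker π × F) ⧸ scaledRelations x π

namespace ScaledExtension

/-- The inclusion of the kernel into the scaled extension. -/
def ι : LinearMap.ker π →ₗ[R] ScaledExtension x π :=
  (scaledRelations x π).mkQ ∘ₗ LinearMap.inl R _ _

/-- The map from the original middle term to the scaled extension. -/
def φ : F →ₗ[R] ScaledExtension x π :=
  (scaledRelations x π).mkQ ∘ₗ LinearMap.inr R _ _

/-- The projection from the scaled extension. -/
def proj : ScaledExtension x π →ₗ[R] M :=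
  (scaledRelations x π).liftQ (π ∘ₗ LinearMap.snd R _ _) <| by
    rintro _ ⟨w, rfl⟩
    simp

/-- The map from the scaled extension to the original middle term. -/
def ψ : ScaledExtension x π →ₗ[R] F :=
  (scaledRelations x π).liftQ ((LinearMap.ker π).subtype.coprod (x • LinearMap.id)) <| by
    rintro _ ⟨w, rfl⟩
    simp

/-- The kernel term is a retract of the scaled extension modulo `x`. -/
def retractMod : ScaledExtension x π →ₗ[R]
    LinearMap.ker π ⧸ LinearMap.range (x • LinearMap.id : LinearMap.ker π →ₗ[R] LinearMap.ker π) :=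
  (scaledRelations x π).liftQ (Submodule.mkQ _ ∘ₗ LinearMap.fst R _ _) <| by
    rintro _ ⟨w, rfl⟩
    exact (Submodule.Quotient.mk_eq_zero _).2 ⟨w, rfl⟩

lemma retractMod_comp_ι : retractMod x π ∘ₗ ι x π = Submodule.mkQ _ := rfl

lemma φ_comp_ψ : φ x π ∘ₗ ψ x π = x • LinearMap.id := by
  refine Submodule.linearMap_qext _ (LinearMap.ext fun ⟨u, f⟩ ↦ ?_)
  refine (Submodule.Quotient.eq _).2 ⟨-u, ?_⟩
  have h : ψ x π (Submodule.Quotient.mk (u, f)) = u + x • f := rfl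
  ext <;> simp [h]

lemma ι_injective : Function.Injective (ι x π) := by
  rw [injective_iff_map_eq_zero]
  intro u hu
  obtain ⟨w, hw⟩ := (Submodule.Quotient.mk_eq_zero _).1 hu
  have h2 : w = 0 := by simpa using congrArg Prod.snd hw
  subst h2
  simpa using (congrArg Prod.fst hw).symm

lemma proj_surjective (hπ : Function.Surjective π) : Function.Surjective (proj x π) := fun m ↦ by
  obtain ⟨f, rfl⟩ := hπ m
  exact ⟨φ x π f, rfl⟩

lemma ι_exact_proj : Function.Exact (ι x π) (proj x π) := by
  intro y
  constructor
  · obtain ⟨⟨u, f⟩, rfl⟩ := Submodule.Quotient.mk_surjective _ y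
    intro (hf : π f = 0)
    refine ⟨u + x • ⟨f, hf⟩, (Submodule.Quotient.eq _).2 ⟨⟨f, hf⟩, ?_⟩⟩
    ext <;> simp
  · rintro ⟨u, rfl⟩
    exact map_zero π

lemma mem_stableAnnihilator [Module.Free R F] [Module.Finite R F] :
    x ∈ stableAnnihilator R (ScaledExtension x π) :=
  mem_stableAnnihilator_of_comp_eq _ _ (φ_comp_ψ x π)

lemma radical_stableAnnihilator_le [Module.Free R F] [Module.Finite R F]
    (hπ : Function.Surjective π) :
    (stableAnnihilator R M).radical ≤ (stableAnnihilator R (ScaledExtension x π)).radical := by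
  rw [Ideal.radical_le_radical_iff]
  intro a ha
  refine ⟨2, ?_⟩
  rw [sq]
  exact mul_mem_stableAnnihilator_of_exact (ι_injective x π) (proj_surjective x π hπ)
    (ι_exact_proj x π) (stableAnnihilator_le_ker hπ ha) ha

end ScaledExtension

end ScaledExtension

section Localization

variable {R : Type} [CommRing R] (p : Ideal R) [p.IsPrime]
variable {L M N : Type} [AddCommGroup L] [Module R L] [AddCommGroup M] [Module R M]
  [AddCommGroup N] [Module R N]

lemma free_localizedModule_of_mem_stableAnnihilator [Module.Finite R M] {a : R}
    (ha : a ∈ stableAnnihilator R M) (hap : a ∉ p) :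
    Module.Free (Localization.AtPrime p) (LocalizedModule p.primeCompl M) := by
  obtain ⟨n, π, hπ⟩ := Module.Finite.exists_fin' R M
  obtain ⟨t, -, ht⟩ := exists_lift_of_mem_finiteFreeMaps hπ ha
  have : Module.Free (Localization.AtPrime p) (LocalizedModule p.primeCompl (Fin n → R)) :=
    Module.free_of_isLocalizedModule p.primeCompl (LocalizedModule.mkLinearMap p.primeCompl _)
  have : Module.Projective (Localization.AtPrime p) (LocalizedModule p.primeCompl M) := by
    refine Module.Projective.of_split
      ((Localization.mk 1 ⟨a, hap⟩ : Localization.AtPrime p) • LocalizedModule.map p.primeCompl t)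
      (LocalizedModule.map p.primeCompl π) ?_
    ext m
    induction m with | h m s =>
    have hm : π (t m) = a • m := LinearMap.congr_fun ht m
    simp only [LinearMap.comp_apply, LinearMap.smul_apply, LocalizedModule.map_mk, hm,
      LinearMap.id_apply, LocalizedModule.mk_smul_mk, one_smul]
    exact LocalizedModule.mk_cancel_common_left ⟨a, hap⟩ s m
  exact Module.free_of_flat_of_isLocalRing

/-- If `ι` becomes split injective modulo some `x ∈ p` and the middle term is free at `p`, so is
the cokernel. -/
lemma free_localizedModule_of_exact [Module.Finite R L] [Module.Finite R M] {x : R} (hx : x ∈ p)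
    {i : L →ₗ[R] M} {q : M →ₗ[R] N} (hq : Function.Surjective q) (hex : Function.Exact i q)
    (ρ : M →ₗ[R] L ⧸ LinearMap.range (x • LinearMap.id : L →ₗ[R] L))
    (hρ : ρ ∘ₗ i = Submodule.mkQ _)
    [Module.Free (Localization.AtPrime p) (LocalizedModule p.primeCompl M)] :
    Module.Free (Localization.AtPrime p) (LocalizedModule p.primeCompl N) := by
  let A := Localization.AtPrime p
  let S := p.primeCompl
  let k := IsLocalRing.ResidueField A
  refine Module.free_of_lTensor_residueField_injective (LocalizedModule.map S i)
    (LocalizedModule.map S q) (LocalizedModule.map_surjective S q hq)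
    (LocalizedModule.map_exact S i q hex) ?_
  have hmk : Function.Injective ((LocalizedModule.map S
      (LinearMap.range (x • LinearMap.id : L →ₗ[R] L)).mkQ).lTensor k) := by
    have hexact : Function.Exact ((LocalizedModule.map S (x • LinearMap.id : L →ₗ[R] L)).lTensor k)
        ((LocalizedModule.map S (LinearMap.range (x • LinearMap.id : L →ₗ[R] L)).mkQ).lTensor k) :=
      lTensor_exact k
        (LocalizedModule.map_exact S _ _ (x • LinearMap.id : L →ₗ[R] L).exact_map_mkQ_range)
        (LocalizedModule.map_surjective S _ (Submodule.mkQ_surjective _))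
    rw [← LinearMap.ker_eq_bot, hexact.linearMap_ker_eq, LinearMap.range_eq_bot]
    have hxk : algebraMap A k (algebraMap R A x) = 0 := by
      rw [IsLocalRing.ResidueField.algebraMap_eq, IsLocalRing.residue_eq_zero_iff]
      exact (IsLocalization.AtPrime.to_map_mem_maximal_iff A p x).2 hx
    have hmap : LocalizedModule.map S (x • LinearMap.id : L →ₗ[R] L) =
        algebraMap R A x • LinearMap.id := by
      ext m
      induction m with | h m s =>
      rw [LocalizedModule.map_mk, LinearMap.smul_apply, LinearMap.smul_apply, LinearMap.id_apply,
        LinearMap.id_apply, algebraMap_smul, LocalizedModule.smul'_mk]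
    rw [hmap, LinearMap.lTensor_smul, LinearMap.lTensor_id]
    refine TensorProduct.ext' fun c m ↦ ?_
    rw [LinearMap.smul_apply, LinearMap.id_apply, TensorProduct.smul_tmul', Algebra.smul_def, hxk,
      zero_mul, TensorProduct.zero_tmul, LinearMap.zero_apply]
  have hcomp : LocalizedModule.map S (ρ ∘ₗ i) =
      LocalizedModule.map S ρ ∘ₗ LocalizedModule.map S i := by
    ext m
    induction m with | h m s => simp [LocalizedModule.map_mk]
  rw [← hρ, hcomp, LinearMap.lTensor_comp, LinearMap.coe_comp] at hmk
  exact hmk.of_comp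

end Localization

section Resolving

variable {R : Type} [CommRing R]

/-- A property of modules that passes to one of the factors of any direct sum holds for some
indecomposable summand of each noetherian module having it. -/
lemma exists_indec_summand (P : ModuleCat.{0} R → Prop) (hP : ∀ A, P A → Nontrivial A)
    (hprod : ∀ M A B : ModuleCat.{0} R, (M ≅ ModuleCat.of R (A × B)) → P M → P A ∨ P B)
    (Y : ModuleCat.{0} R) [IsNoetherian R Y] (hY : P Y) :
    ∃ A, IsSummand R A Y ∧ P A ∧ Indec R A := by
  let T : Set (Submodule R Y) :=
    {K | ∃ (A : ModuleCat.{0} R) (i : A ⟶ Y) (q : Y ⟶ A), i ≫ q = 𝟙 A ∧ P A ∧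
      LinearMap.ker q.hom = K}
  obtain ⟨K, ⟨A, i, q, hiq, hA, rfl⟩, hmax⟩ := set_has_maximal_iff_noetherian.2 ‹_› T
    ⟨_, Y, 𝟙 Y, 𝟙 Y, Category.id_comp _, hY, rfl⟩
  refine ⟨A, ⟨i, q, hiq⟩, hA, hP A hA, fun B C hB hC ↦ ⟨fun e ↦ ?_⟩⟩
  have key : ∀ (D E : ModuleCat.{0} R) (j : D ⟶ A) (r : A ⟶ D) (k : E ⟶ A), j ≫ r = 𝟙 D →
      k ≫ r = 0 → Function.Injective k → Nontrivial E → ¬ P D := by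
    intro D E j r k hjr hkr hk hE hD
    refine hmax _ ⟨D, j ≫ i, q ≫ r, ?_, hD, rfl⟩ ?_
    · rw [Category.assoc, ← Category.assoc i, hiq, Category.id_comp, hjr]
    have hle : LinearMap.ker q.hom ≤ LinearMap.ker (q ≫ r).hom := by
      rw [ModuleCat.hom_comp]
      exact LinearMap.ker_le_ker_comp _ _
    refine lt_of_le_of_ne hle fun heq ↦ ?_
    obtain ⟨z, hz⟩ := exists_ne (0 : E)
    have hqi : ∀ a, q (i a) = a := fun a ↦ DFunLike.congr_fun (congrArg ModuleCat.Hom.hom hiq) a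
    have hrk : r (k z) = 0 := DFunLike.congr_fun (congrArg ModuleCat.Hom.hom hkr) z
    have hmem : i (k z) ∈ LinearMap.ker (q ≫ r).hom := by
      change r (q (i (k z))) = 0
      rw [hqi, hrk]
    rw [← heq] at hmem
    have hkz : k z = 0 := (hqi _).symm.trans hmem
    exact hz (hk (hkz.trans (map_zero k.hom).symm))
  have hinj : Function.Injective e.inv := e.symm.toLinearEquiv.injective
  rcases hprod A B C e hA with h | h
  · refine key B C (ModuleCat.ofHom (LinearMap.inl R B C) ≫ e.inv)
      (e.hom ≫ ModuleCat.ofHom (LinearMap.fst R B C))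
      (ModuleCat.ofHom (LinearMap.inr R B C) ≫ e.inv) ?_ ?_ ?_ hC h
    · rw [Category.assoc, e.inv_hom_id_assoc]; rfl
    · rw [Category.assoc, e.inv_hom_id_assoc]; rfl
    · exact hinj.comp LinearMap.inr_injective
  · refine key C B (ModuleCat.ofHom (LinearMap.inr R B C) ≫ e.inv)
      (e.hom ≫ ModuleCat.ofHom (LinearMap.snd R B C))
      (ModuleCat.ofHom (LinearMap.inl R B C) ≫ e.inv) ?_ ?_ ?_ hB h
    · rw [Category.assoc, e.inv_hom_id_assoc]; rfl
    · rw [Category.assoc, e.inv_hom_id_assoc]; rfl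
    · exact hinj.comp LinearMap.inl_injective

lemma isResolving_finite [IsNoetherianRing R] :
    IsResolving R {M : ModuleCat.{0} R | Module.Finite R M} where
  finite _ h := h
  iso_closed _ _ := fun ⟨e⟩ (_ : Module.Finite R _) ↦ Module.Finite.equiv e.toLinearEquiv
  proj_mem _ h _ := h
  summand_closed _ _ := fun ⟨i, q, h⟩ (_ : Module.Finite R _) ↦
    Module.Finite.of_surjective q.hom fun x ↦
      ⟨i x, DFunLike.congr_fun (congrArg ModuleCat.Hom.hom h) x⟩
  ext_closed _ _ _ := fun ⟨f, g, _, _, hex⟩ (_ : Module.Finite R _) (_ : Module.Finite R _) ↦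
    have := isNoetherian_of_range_eq_ker f.hom g.hom hex.linearMap_ker_eq.symm
    Module.IsNoetherian.finite R _
  ker_epi_closed _ _ _ := fun ⟨f, _, hf, _, _⟩ (_ : Module.Finite R _) _ ↦
    Module.Finite.of_injective f.hom hf

lemma isResolving_resClosure [IsNoetherianRing R] {𝒳 : Set (ModuleCat.{0} R)}
    (h𝒳 : ∀ X ∈ 𝒳, Module.Finite R X) : IsResolving R (resClosure R 𝒳) where
  finite _ h := h _ ⟨isResolving_finite, h𝒳⟩
  iso_closed _ _ e h 𝒴 h𝒴 := h𝒴.1.iso_closed _ _ e (h 𝒴 h𝒴)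
  proj_mem _ hf hp _ h𝒴 := h𝒴.1.proj_mem _ hf hp
  summand_closed _ _ e h 𝒴 h𝒴 := h𝒴.1.summand_closed _ _ e (h 𝒴 h𝒴)
  ext_closed _ _ _ e h h' 𝒴 h𝒴 := h𝒴.1.ext_closed _ _ _ e (h 𝒴 h𝒴) (h' 𝒴 h𝒴)
  ker_epi_closed _ _ _ e h h' 𝒴 h𝒴 := h𝒴.1.ker_epi_closed _ _ _ e (h 𝒴 h𝒴) (h' 𝒴 h𝒴)

lemma IsResolving.ker_mem {𝒴 : Set (ModuleCat.{0} R)} (h𝒴 : IsResolving R 𝒴)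
    {M : ModuleCat.{0} R} (hM : M ∈ 𝒴) {n : ℕ} {π : (Fin n → R) →ₗ[R] M}
    (hπ : Function.Surjective π) : ModuleCat.of R (LinearMap.ker π) ∈ 𝒴 :=
  h𝒴.ker_epi_closed _ (ModuleCat.of R (Fin n → R)) M
    ⟨ModuleCat.ofHom (LinearMap.ker π).subtype, ModuleCat.ofHom π, Subtype.val_injective, hπ,
      LinearMap.exact_subtype_ker_map π⟩
    (h𝒴.proj_mem _ inferInstance inferInstance) hM

lemma IsResolving.scaledExtension_mem {𝒴 : Set (ModuleCat.{0} R)} (h𝒴 : IsResolving R 𝒴)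
    {M : ModuleCat.{0} R} (hM : M ∈ 𝒴) {n : ℕ} {π : (Fin n → R) →ₗ[R] M}
    (hπ : Function.Surjective π) (x : R) : ModuleCat.of R (ScaledExtension x π) ∈ 𝒴 :=
  h𝒴.ext_closed _ _ M
    ⟨ModuleCat.ofHom (ScaledExtension.ι x π), ModuleCat.ofHom (ScaledExtension.proj x π),
      ScaledExtension.ι_injective x π, ScaledExtension.proj_surjective x π hπ,
      ScaledExtension.ι_exact_proj x π⟩
    (h𝒴.ker_mem hM hπ) hM

/-- A resolving class that is not locally free at `p` contains a module that is not free at `p`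
and whose stable annihilator has radical containing `p`. -/
lemma IsResolving.exists_le_radical_stableAnnihilator [IsNoetherianRing R]
    {𝒴 : Set (ModuleCat.{0} R)} (h𝒴 : IsResolving R 𝒴) {p : PrimeSpectrum R}
    (hp : p ∈ nonfreeLocusSet R 𝒴) :
    ∃ Y ∈ 𝒴, p ∈ nonfreeLocus R Y ∧ p.asIdeal ≤ (stableAnnihilator R Y).radical := by
  obtain ⟨X, hX, hpX⟩ := Set.mem_iUnion₂.1 hp
  let T : Set (Ideal R) :=
    {I | ∃ Y ∈ 𝒴, p ∈ nonfreeLocus R Y ∧ (stableAnnihilator R Y).radical = I}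
  obtain ⟨I, ⟨Y, hY, hpY, rfl⟩, hmax⟩ :=
    set_has_maximal_iff_noetherian.2 ‹_› T ⟨_, X, hX, hpX, rfl⟩
  refine ⟨Y, hY, hpY, fun x hx ↦ ?_⟩
  have := h𝒴.finite Y hY
  obtain ⟨n, π, hπ⟩ := Module.Finite.exists_fin' R Y
  have hle := ScaledExtension.radical_stableAnnihilator_le x π hπ
  have hmem := h𝒴.scaledExtension_mem hY hπ x
  have hnf : p ∈ nonfreeLocus R (ModuleCat.of R (ScaledExtension x π)) := by
    intro (hfree : Module.Free (Localization.AtPrime p.asIdeal)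
      (LocalizedModule p.asIdeal.primeCompl (ScaledExtension x π)))
    exact hpY (free_localizedModule_of_exact p.asIdeal hx (ScaledExtension.proj_surjective x π hπ)
      (ScaledExtension.ι_exact_proj x π) (ScaledExtension.retractMod x π)
      (ScaledExtension.retractMod_comp_ι x π))
  have heq := eq_of_le_of_not_lt hle (hmax _ ⟨_, hmem, hnf, rfl⟩)
  rw [heq]
  exact Ideal.le_radical (ScaledExtension.mem_stableAnnihilator x π)

end Resolving

section ExtAnnihilator

variable {R : Type} [CommRing R]

lemma stableAnnihilator_le_annihilator_ext1 (Y Z : ModuleCat.{0} R) :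
    stableAnnihilator R Y ≤ Module.annihilator R (ext1 R Y Z) := by
  intro a ha
  obtain ⟨P, π, -, hπ, hann⟩ := exists_projective_mem_annihilator_ext1_iff Y
  refine (hann Z a).2 fun h ↦ ?_
  obtain ⟨r, hr⟩ := exists_retraction_of_mem_stableAnnihilator hπ ha
  exact ⟨h ∘ₗ r, fun w ↦ by rw [LinearMap.comp_apply, hr, map_smul]⟩

lemma annihilator_ext1_ker_le {Y : ModuleCat.{0} R} {n : ℕ} {ρ : (Fin n → R) →ₗ[R] Y}
    (hρ : Function.Surjective ρ) :
    Module.annihilator R (ext1 R Y (ModuleCat.of R (LinearMap.ker ρ))) ≤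
      stableAnnihilator R Y := by
  intro a ha
  obtain ⟨P, π, hP, hπ, hann⟩ := exists_projective_mem_annihilator_ext1_iff Y
  obtain ⟨φ, hφ⟩ := Module.projective_lifting_property ρ π hρ
  have hφ' : ∀ x, ρ (φ x) = π x := fun x ↦ LinearMap.congr_fun hφ x
  let h : LinearMap.ker π →ₗ[R] LinearMap.ker ρ :=
    φ.restrict fun x (hx : π x = 0) ↦ show ρ (φ x) = 0 by rw [hφ', hx]
  obtain ⟨g, hg⟩ := (hann _ a).1 ha h
  let g' : P →ₗ[R] LinearMap.ker ρ := g
  have hker : LinearMap.ker π ≤ LinearMap.ker (a • φ - (LinearMap.ker ρ).subtype ∘ₗ g') := by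
    intro w hw
    have hgw : (g' w : Fin n → R) = a • φ w := congrArg Subtype.val (hg ⟨w, hw⟩)
    simp [hgw]
  let t : Y →ₗ[R] (Fin n → R) := (LinearMap.ker π).liftQ _ hker ∘ₗ
    (π.quotKerEquivOfSurjective hπ).symm.toLinearMap
  have ht : ∀ x, t (π x) = a • φ x - g' x := fun x ↦ by
    have : (π.quotKerEquivOfSurjective hπ).symm (π x) = Submodule.Quotient.mk x := by
      rw [LinearEquiv.symm_apply_eq]; rfl
    simp [t, this]
  refine mem_stableAnnihilator_of_comp_eq t ρ (LinearMap.ext fun y ↦ ?_)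
  obtain ⟨x, rfl⟩ := hπ y
  have hgx : ρ (g' x) = 0 := (g' x).2
  simp [ht, hφ', hgx]

lemma annihilator_ext1_inf_le_of_iso_prod (Y : ModuleCat.{0} R) {Z A B : ModuleCat.{0} R}
    (e : Z ≅ ModuleCat.of R (A × B)) :
    Module.annihilator R (ext1 R Y A) ⊓ Module.annihilator R (ext1 R Y B) ≤
      Module.annihilator R (ext1 R Y Z) := by
  rintro a ⟨hA, hB⟩
  obtain ⟨P, π, -, -, hann⟩ := exists_projective_mem_annihilator_ext1_iff Y
  refine (hann Z a).2 fun h ↦ ?_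
  let e' : Z ≃ₗ[R] A × B := e.toLinearEquiv
  obtain ⟨g₁, hg₁⟩ := (hann A a).1 hA (LinearMap.fst R A B ∘ₗ e'.toLinearMap ∘ₗ h)
  obtain ⟨g₂, hg₂⟩ := (hann B a).1 hB (LinearMap.snd R A B ∘ₗ e'.toLinearMap ∘ₗ h)
  refine ⟨e'.symm.toLinearMap ∘ₗ g₁.prod g₂, fun w ↦ ?_⟩
  rw [LinearMap.comp_apply, LinearEquiv.coe_coe, LinearEquiv.symm_apply_eq, map_smul]
  exact Prod.ext (hg₁ w) (hg₂ w)

lemma annihilator_ext1_eq_top_of_subsingleton (Y Z : ModuleCat.{0} R) [Subsingleton Z] :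
    Module.annihilator R (ext1 R Y Z) = ⊤ := by
  obtain ⟨P, π, -, -, hann⟩ := exists_projective_mem_annihilator_ext1_iff Y
  exact Ideal.eq_top_iff_one _ |>.2 ((hann Z 1).2 fun _ ↦ ⟨0, fun _ ↦ Subsingleton.elim _ _⟩)

lemma stableAnnihilator_eq_top_of_subsingleton (M : Type) [AddCommGroup M] [Module R M]
    [Subsingleton M] : stableAnnihilator R M = ⊤ :=
  (Ideal.eq_top_iff_one _).2 <| mem_stableAnnihilator_of_comp_eq (F := M) LinearMap.id LinearMap.id
    (LinearMap.ext fun _ ↦ Subsingleton.elim _ _)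

end ExtAnnihilator

/-- Every prime in `NF(𝒳)` is the radical of the annihilator of
`Ext¹_R(Y, Z)` for some indecomposable `Y, Z` in the resolving closure of `𝒳`. -/
theorem stmt17 (R : Type) [CommRing R] [IsNoetherianRing R]
    (𝒳 : Set (ModuleCat R)) (h𝒳 : ∀ X ∈ 𝒳, Module.Finite R X)
    (p : PrimeSpectrum R) (hp : p ∈ nonfreeLocusSet R 𝒳) :
    ∃ Y Z : ModuleCat R, Y ∈ resClosure R 𝒳 ∧ Z ∈ resClosure R 𝒳 ∧
      Indec R Y ∧ Indec R Z ∧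
      p.asIdeal = (Module.annihilator R ↥(ext1 R Y Z)).radical := by
  have hC := isResolving_resClosure h𝒳
  have hsub : 𝒳 ⊆ resClosure R 𝒳 := fun X hX 𝒴 h𝒴 ↦ h𝒴.2 hX
  obtain ⟨W, hW, hpW, hWrad⟩ := hC.exists_le_radical_stableAnnihilator
    (Set.biUnion_subset_biUnion_left hsub hp)
  have := hC.finite W hW
  have hWp : stableAnnihilator R W ≤ p.asIdeal := fun a ha ↦ by
    by_contra hap
    exact hpW (free_localizedModule_of_mem_stableAnnihilator p.asIdeal ha hap)
  obtain ⟨Y, hYW, hYp, hYindec⟩ := exists_indec_summand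
    (fun A ↦ stableAnnihilator R A ≤ p.asIdeal)
    (fun A hA ↦ by
      by_contra hA'
      rw [not_nontrivial_iff_subsingleton] at hA'
      rw [stableAnnihilator_eq_top_of_subsingleton, top_le_iff] at hA
      exact p.2.ne_top hA)
    (fun M A B e hM ↦ p.2.inf_le.1 <| stableAnnihilator_inf_le_prod.trans <|
      (stableAnnihilator_le_of_retract e.hom.hom e.inv.hom
        (congrArg ModuleCat.Hom.hom e.hom_inv_id)).trans hM)
    W hWp
  have hY := hC.summand_closed _ _ hYW hW
  have := hC.finite Y hY
  obtain ⟨n, ρ, hρ⟩ := Module.Finite.exists_fin' R Y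
  obtain ⟨Z, hZker, hZp, hZindec⟩ := exists_indec_summand
    (fun A ↦ Module.annihilator R (ext1 R Y A) ≤ p.asIdeal)
    (fun A hA ↦ by
      by_contra hA'
      rw [not_nontrivial_iff_subsingleton] at hA'
      rw [annihilator_ext1_eq_top_of_subsingleton, top_le_iff] at hA
      exact p.2.ne_top hA)
    (fun M A B e hM ↦ p.2.inf_le.1 ((annihilator_ext1_inf_le_of_iso_prod Y e).trans hM))
    (ModuleCat.of R (LinearMap.ker ρ)) ((annihilator_ext1_ker_le hρ).trans hYp)
  refine ⟨Y, Z, hY, hC.summand_closed _ _ hZker (hC.ker_mem hY hρ), hYindec, hZindec,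
    le_antisymm (hWrad.trans (Ideal.radical_mono ?_)) (p.2.radical_le_iff.2 hZp)⟩
  obtain ⟨i, q, hiq⟩ := hYW
  exact (stableAnnihilator_le_of_retract i.hom q.hom (congrArg ModuleCat.Hom.hom hiq)).trans
    (stableAnnihilator_le_annihilator_ext1 Y Z)
end
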